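/- arXiv:0807.0798 — 5 statements merged into one kernel-verified Lean document; each statement's English description precedes it below -/
import Mathlib

section
/- Let r ≥ 3 be a natural number. The following 8(r−1) functions on SL(3,ℂ)^r are algebraically independent over ℂ in the ℂ-algebra of all functions SL(3,ℂ)^r → ℂ: the eight functions tr(X₁), tr(X₂), tr(X₁⁻¹), tr(X₂⁻¹), tr(X₁X₂), tr(X₁⁻¹X₂), tr(X₂⁻¹X₁), tr(X₁⁻¹X₂⁻¹), together with, for each k with 3 ≤ k ≤ r, the eight functions tr(X_k), tr(X_k⁻¹), tr(X₁X_k), tr(X₂X_k), tr(X₁X_k⁻¹), tr(X₁⁻¹X_k⁻¹), tr(X₁⁻¹X_k), tr(X₂⁻¹X_k⁻¹). -/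
/-- `SL(3,ℂ)`. -/
abbrev SL3 := Matrix.SpecialLinearGroup (Fin 3) ℂ

/-- Trace of an element of `SL(3,ℂ)`, as the trace of the underlying matrix. -/
noncomputable def tr3 (X : SL3) : ℂ := Matrix.trace (X : Matrix (Fin 3) (Fin 3) ℂ)

/-- The eight functions tr X₁, tr X₂, tr X₁⁻¹, tr X₂⁻¹, tr X₁X₂, tr X₁⁻¹X₂,
tr X₂⁻¹X₁, tr X₁⁻¹X₂⁻¹ (indices here are 0-based: X₁ = X 0, X₂ = X 1). -/
noncomputable def baseBlock (r : ℕ) (hr : 3 ≤ r) (j : Fin 8) (X : Fin r → SL3) : ℂ :=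
  ![tr3 (X ⟨0, by omega⟩),
    tr3 (X ⟨1, by omega⟩),
    tr3 (X ⟨0, by omega⟩)⁻¹,
    tr3 (X ⟨1, by omega⟩)⁻¹,
    tr3 (X ⟨0, by omega⟩ * X ⟨1, by omega⟩),
    tr3 ((X ⟨0, by omega⟩)⁻¹ * X ⟨1, by omega⟩),
    tr3 ((X ⟨1, by omega⟩)⁻¹ * X ⟨0, by omega⟩),
    tr3 ((X ⟨0, by omega⟩)⁻¹ * (X ⟨1, by omega⟩)⁻¹)] j

open Topology Filter

set_option linter.unusedSimpArgs false

abbrev E8 := Fin 8 → ℂ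

def J1 : Matrix (Fin 8) (Fin 8) ℤ :=
  !![0, 1, 0, 0, 0, 0, 0, 0;
    0, 0, 1, 0, 1, 0, 1, 1;
    -1, -1, 0, 0, 0, 0, 0, 0;
    0, 0, -1, 0, -1, 0, 0, -1;
    0, 0, 0, 0, -1, 1, 0, -1;
    1, 0, 0, 1, -1, -1, 0, 0;
    0, 0, 0, 1, -1, 0, 0, 0;
    0, -1, 0, 0, -2, 1, 0, -1]

def K1 : Matrix (Fin 8) (Fin 8) ℤ :=
  !![-1, 0, -1, 0, 0, 0, 0, 0;
    1, 0, 0, 0, 0, 0, 0, 0;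
    1, 0, 1, -1, 1, 1, -1, 0;
    -1, 0, 0, 0, 1, 0, 1, -1;
    -1, 0, 0, 0, 1, 0, 0, -1;
    -1, 0, -1, 0, 0, -1, 1, 0;
    0, 1, 0, 1, 0, 0, 0, 0;
    0, 0, -1, 0, -2, -1, 1, 1]

def J3 : Matrix (Fin 8) (Fin 8) ℤ :=
  !![1, 0, 1, 0, 0, -1, 0, 0;
    -1, 0, -1, 0, 1, 0, 0, -1;
    0, 0, 0, 1, -1, 0, 0, -1;
    -1, 0, 0, 0, -1, 0, 1, 0;
    0, 1, 0, 0, -1, 0, 1, 0;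
    0, 0, 1, 1, -1, 0, 1, -1;
    0, 1, 0, 0, -1, 0, 0, 1;
    -1, 0, 0, 0, -1, -1, 1, -1]

def K3 : Matrix (Fin 8) (Fin 8) ℤ :=
  !![1, 0, 1, 1, 1, -1, -1, -1;
    -1, 0, -1, -2, 0, 1, 1, 1;
    -2, -1, -2, -3, -1, 2, 1, 2;
    3, 2, 2, 4, 0, -1, 0, -3;
    1, 1, 0, 1, 0, 0, 0, -1;
    -2, -1, -1, -2, 0, 1, 0, 1;
    2, 1, 1, 3, 1, -1, -1, -2;
    2, 1, 1, 3, 0, -1, 0, -2]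
lemma J1K1 : J1 * K1 = 1 := by decide +kernel

lemma J3K3 : J3 * K3 = 1 := by decide +kernel

/-- Smoothness of matrix valued maps, entrywise. -/
def Sm {E : Type*} [NormedAddCommGroup E] [NormedSpace ℂ E] (f : E → SL3) : Prop :=
  ∀ i j, ContDiff ℂ 1 (fun x => (f x : Matrix (Fin 3) (Fin 3) ℂ) i j)

section
variable {E F : Type*} [NormedAddCommGroup E] [NormedSpace ℂ E]
  [NormedAddCommGroup F] [NormedSpace ℂ F]

lemma Sm.mul {f g : E → SL3} (hf : Sm f) (hg : Sm g) : Sm (fun x => f x * g x) := by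
  intro i j
  simp only [Matrix.SpecialLinearGroup.coe_mul, Matrix.mul_apply]
  exact ContDiff.sum fun k _ => (hf i k).mul (hg k j)

lemma Sm.const (A : SL3) : Sm (fun _ : E => A) := fun _ _ => contDiff_const

lemma Sm.inv {f : E → SL3} (hf : Sm f) : Sm (fun x => (f x)⁻¹) := by
  intro i j
  simp only [Matrix.SpecialLinearGroup.coe_inv, Matrix.adjugate_fin_three]
  have h := hf
  unfold Sm at h
  fin_cases i <;> fin_cases j <;> simp <;>
    (first
      | exact ((h _ _).mul (h _ _)).sub ((h _ _).mul (h _ _))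
      | exact (((h _ _).mul (h _ _)).neg).add ((h _ _).mul (h _ _)))

lemma Sm.comp {f : E → SL3} (hf : Sm f) {g : F → E} (hg : ContDiff ℂ 1 g) :
    Sm (fun x => f (g x)) := fun i j => (hf i j).comp hg

lemma Sm.tr {f : E → SL3} (hf : Sm f) : ContDiff ℂ 1 (fun x => tr3 (f x)) := by
  simp only [tr3, Matrix.trace, Matrix.diag]
  exact ContDiff.sum fun k _ => hf k k
end

def S0 (t : ℂ) : SL3 := ⟨!![1, t, 0; 0, 1, 0; 0, 0, 1], by simp [Matrix.det_fin_three]⟩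
def S1 (t : ℂ) : SL3 := ⟨!![1, 0, t; 0, 1, 0; 0, 0, 1], by simp [Matrix.det_fin_three]⟩
def S2 (t : ℂ) : SL3 := ⟨!![1, 0, 0; t, 1, 0; 0, 0, 1], by simp [Matrix.det_fin_three]⟩
def S3 (t : ℂ) : SL3 := ⟨!![1, 0, 0; 0, 1, t; 0, 0, 1], by simp [Matrix.det_fin_three]⟩
def S4 (t : ℂ) : SL3 := ⟨!![1, 0, 0; 0, 1, 0; t, 0, 1], by simp [Matrix.det_fin_three]⟩
def S5 (t : ℂ) : SL3 := ⟨!![1, 0, 0; 0, 1, 0; 0, t, 1], by simp [Matrix.det_fin_three]⟩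
def S6 (t : ℂ) : SL3 :=
  ⟨!![1 + t, -t, 0; t, 1 - t, 0; 0, 0, 1], by simp [Matrix.det_fin_three]; ring⟩
def S7 (t : ℂ) : SL3 :=
  ⟨!![1, 0, 0; 0, 1 + t, -t; 0, t, 1 - t], by simp [Matrix.det_fin_three]; ring⟩

lemma S0_zero : S0 0 = 1 := by
  ext i j; fin_cases i <;> fin_cases j <;> simp [S0]
lemma S1_zero : S1 0 = 1 := by
  ext i j; fin_cases i <;> fin_cases j <;> simp [S1]
lemma S2_zero : S2 0 = 1 := by
  ext i j; fin_cases i <;> fin_cases j <;> simp [S2]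
lemma S3_zero : S3 0 = 1 := by
  ext i j; fin_cases i <;> fin_cases j <;> simp [S3]
lemma S4_zero : S4 0 = 1 := by
  ext i j; fin_cases i <;> fin_cases j <;> simp [S4]
lemma S5_zero : S5 0 = 1 := by
  ext i j; fin_cases i <;> fin_cases j <;> simp [S5]
lemma S6_zero : S6 0 = 1 := by
  ext i j; fin_cases i <;> fin_cases j <;> simp [S6]
lemma S7_zero : S7 0 = 1 := by
  ext i j; fin_cases i <;> fin_cases j <;> simp [S7]

lemma smS0 : Sm S0 := by
  intro i j; fin_cases i <;> fin_cases j <;> simp [S0] <;> fun_prop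
lemma smS1 : Sm S1 := by
  intro i j; fin_cases i <;> fin_cases j <;> simp [S1] <;> fun_prop
lemma smS2 : Sm S2 := by
  intro i j; fin_cases i <;> fin_cases j <;> simp [S2] <;> fun_prop
lemma smS3 : Sm S3 := by
  intro i j; fin_cases i <;> fin_cases j <;> simp [S3] <;> fun_prop
lemma smS4 : Sm S4 := by
  intro i j; fin_cases i <;> fin_cases j <;> simp [S4] <;> fun_prop
lemma smS5 : Sm S5 := by
  intro i j; fin_cases i <;> fin_cases j <;> simp [S5] <;> fun_prop
lemma smS6 : Sm S6 := by
  intro i j; fin_cases i <;> fin_cases j <;> simp [S6] <;> fun_prop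
lemma smS7 : Sm S7 := by
  intro i j; fin_cases i <;> fin_cases j <;> simp [S7] <;> fun_prop

def M1 : SL3 := ⟨!![0, 1, 0; 1, 0, 0; 1, 0, -1], by simp [Matrix.det_fin_three]⟩
def M2 : SL3 := ⟨!![0, 1, 0; 1, -1, 1; 0, 0, -1], by simp [Matrix.det_fin_three]⟩
def M3 : SL3 := ⟨!![0, 1, 0; 1, 0, -1; 0, 0, -1], by simp [Matrix.det_fin_three]⟩
lemma S0_val (t : ℂ) : ((S0 t : SL3) : Matrix (Fin 3) (Fin 3) ℂ) =
    !![1, t, 0; 0, 1, 0; 0, 0, 1] := rfl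
lemma S1_val (t : ℂ) : ((S1 t : SL3) : Matrix (Fin 3) (Fin 3) ℂ) =
    !![1, 0, t; 0, 1, 0; 0, 0, 1] := rfl
lemma S2_val (t : ℂ) : ((S2 t : SL3) : Matrix (Fin 3) (Fin 3) ℂ) =
    !![1, 0, 0; t, 1, 0; 0, 0, 1] := rfl
lemma S3_val (t : ℂ) : ((S3 t : SL3) : Matrix (Fin 3) (Fin 3) ℂ) =
    !![1, 0, 0; 0, 1, t; 0, 0, 1] := rfl
lemma S4_val (t : ℂ) : ((S4 t : SL3) : Matrix (Fin 3) (Fin 3) ℂ) =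
    !![1, 0, 0; 0, 1, 0; t, 0, 1] := rfl
lemma S5_val (t : ℂ) : ((S5 t : SL3) : Matrix (Fin 3) (Fin 3) ℂ) =
    !![1, 0, 0; 0, 1, 0; 0, t, 1] := rfl
lemma S6_val (t : ℂ) : ((S6 t : SL3) : Matrix (Fin 3) (Fin 3) ℂ) =
    !![1 + t, -t, 0; t, 1 - t, 0; 0, 0, 1] := rfl
lemma S7_val (t : ℂ) : ((S7 t : SL3) : Matrix (Fin 3) (Fin 3) ℂ) =
    !![1, 0, 0; 0, 1 + t, -t; 0, t, 1 - t] := rfl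
lemma M1_val : ((M1 : SL3) : Matrix (Fin 3) (Fin 3) ℂ) =
    !![0, 1, 0; 1, 0, 0; 1, 0, -1] := rfl
lemma M2_val : ((M2 : SL3) : Matrix (Fin 3) (Fin 3) ℂ) =
    !![0, 1, 0; 1, -1, 1; 0, 0, -1] := rfl
lemma M3_val : ((M3 : SL3) : Matrix (Fin 3) (Fin 3) ℂ) =
    !![0, 1, 0; 1, 0, -1; 0, 0, -1] := rfl

def X1 (a : E8) : SL3 := M1 * (S3 (a 0) * S0 (a 1))
def X2 (a : E8) : SL3 :=
  M2 * (S0 (a 2) * S1 (a 3) * S2 (a 4) * S3 (a 5) * S5 (a 6) * S7 (a 7))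
def X3 (a : E8) : SL3 :=
  M3 * (S0 (a 0) * S1 (a 1) * S2 (a 2) * S3 (a 3) * S4 (a 4) * S5 (a 5) * S6 (a 6) * S7 (a 7))

lemma smco {f : ℂ → SL3} (hf : Sm f) (j : Fin 8) : Sm (fun a : E8 => f (a j)) :=
  hf.comp (g := fun a : E8 => a j) (by fun_prop)

lemma smX1 : Sm X1 :=
  (Sm.const M1).mul ((smco smS3 0).mul (smco smS0 1))
lemma smX2 : Sm X2 :=
  (Sm.const M2).mul ((((((smco smS0 2).mul (smco smS1 3)).mul (smco smS2 4)).mul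
    (smco smS3 5)).mul (smco smS5 6)).mul (smco smS7 7))
lemma smX3 : Sm X3 :=
  (Sm.const M3).mul ((((((((smco smS0 0).mul (smco smS1 1)).mul (smco smS2 2)).mul
    (smco smS3 3)).mul (smco smS4 4)).mul (smco smS5 5)).mul (smco smS6 6)).mul (smco smS7 7))

noncomputable def baseF (Y1 Y2 : SL3) : E8 :=
  ![tr3 Y1, tr3 Y2, tr3 Y1⁻¹, tr3 Y2⁻¹, tr3 (Y1 * Y2), tr3 (Y1⁻¹ * Y2), tr3 (Y2⁻¹ * Y1),
    tr3 (Y1⁻¹ * Y2⁻¹)]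

noncomputable def nextF (Y1 Y2 Y : SL3) : E8 :=
  ![tr3 Y, tr3 Y⁻¹, tr3 (Y1 * Y), tr3 (Y2 * Y), tr3 (Y1 * Y⁻¹), tr3 (Y1⁻¹ * Y⁻¹),
    tr3 (Y1⁻¹ * Y), tr3 (Y2⁻¹ * Y⁻¹)]

noncomputable def G1 (a : E8) : E8 := baseF (X1 a) (X2 a)
noncomputable def G3 (p : E8 × E8) : E8 := nextF (X1 p.1) (X2 p.1) (X3 p.2)

lemma smG1 : ContDiff ℂ 1 G1 := by
  rw [contDiff_pi]
  have h1 := smX1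
  have h2 := smX2
  intro i
  fin_cases i
  · exact h1.tr
  · exact h2.tr
  · exact h1.inv.tr
  · exact h2.inv.tr
  · exact (h1.mul h2).tr
  · exact (h1.inv.mul h2).tr
  · exact (h2.inv.mul h1).tr
  · exact (h1.inv.mul h2.inv).tr

lemma smG3 : ContDiff ℂ 1 G3 := by
  rw [contDiff_pi]
  have h1 : Sm (fun p : E8 × E8 => X1 p.1) := smX1.comp contDiff_fst
  have h2 : Sm (fun p : E8 × E8 => X2 p.1) := smX2.comp contDiff_fst
  have h3 : Sm (fun p : E8 × E8 => X3 p.2) := smX3.comp contDiff_snd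
  intro i
  fin_cases i
  · exact h3.tr
  · exact h3.inv.tr
  · exact (h1.mul h3).tr
  · exact (h2.mul h3).tr
  · exact (h1.mul h3.inv).tr
  · exact (h1.inv.mul h3.inv).tr
  · exact (h1.inv.mul h3).tr
  · exact (h2.inv.mul h3.inv).tr

/-- A criterion for surjectivity of the derivative at the origin. -/
lemma surj_of_curves (G : E8 → E8) (hG : DifferentiableAt ℂ G 0)
    (J K : Matrix (Fin 8) (Fin 8) ℤ) (hJK : J * K = 1)
    (h : ∀ i j t, G (Pi.single j t) i = G 0 i + t * (J i j : ℂ)) :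
    Function.Surjective (fderiv ℂ G 0) := by
  have hd : ∀ i j, fderiv ℂ G 0 (Pi.single j 1) i = (J i j : ℂ) := by
    intro i j
    have hline : HasDerivAt (fun t : ℂ => (Pi.single j t : E8)) (Pi.single j 1) 0 := by
      rw [hasDerivAt_pi]
      intro k
      by_cases hk : k = j
      · subst hk; simpa using hasDerivAt_id' (0 : ℂ)
      · simpa [Pi.single_eq_of_ne hk] using hasDerivAt_const (0 : ℂ) (0 : ℂ)
    have h1 : HasFDerivAt G (fderiv ℂ G 0) (Pi.single j (0 : ℂ)) := by
      simpa using hG.hasFDerivAt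
    have h2 := h1.comp_hasDerivAt (0 : ℂ) hline
    have h3 := (hasDerivAt_pi.1 h2) i
    have h4 : HasDerivAt (fun t : ℂ => G 0 i + t * (J i j : ℂ)) (J i j : ℂ) 0 := by
      simpa using ((hasDerivAt_id (0 : ℂ)).mul_const (J i j : ℂ)).const_add (G 0 i)
    have h5 : (fun t : ℂ => (G ∘ fun t : ℂ => (Pi.single j t : E8)) t i)
        = (fun t : ℂ => G 0 i + t * (J i j : ℂ)) := by
      funext t; exact h i j t
    rw [h5] at h3
    exact h3.unique h4
  have hcast : (J.map (Int.cast : ℤ → ℂ)) * (K.map (Int.cast : ℤ → ℂ)) = 1 := by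
    have := congrArg (fun A : Matrix (Fin 8) (Fin 8) ℤ => A.map (Int.castRingHom ℂ)) hJK
    rw [Matrix.map_mul] at this
    simpa using this
  have hlin : ∀ v, fderiv ℂ G 0 v = (J.map (Int.cast : ℤ → ℂ)).mulVec v := by
    intro v
    funext i
    conv_lhs => rw [pi_eq_sum_univ' v]
    simp only [map_sum, map_smul, Finset.sum_apply, Pi.smul_apply, smul_eq_mul, Matrix.mulVec,
      dotProduct, Matrix.map_apply]
    refine Finset.sum_congr rfl fun j _ => ?_
    have e : (fun k => if j = k then (1:ℂ) else 0) = Pi.single j 1 := by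
      funext k; by_cases hk : j = k
      · subst hk; simp
      · simp [hk]
    have := hd i j
    rw [← e] at this
    rw [← this, e, mul_comm]
  intro c
  refine ⟨(K.map (Int.cast : ℤ → ℂ)).mulVec c, ?_⟩
  rw [hlin, Matrix.mulVec_mulVec, hcast, Matrix.one_mulVec]

lemma open_of_surj {E F : Type*} [NormedAddCommGroup E] [NormedSpace ℂ E] [CompleteSpace E]
    [NormedAddCommGroup F] [NormedSpace ℂ F] [CompleteSpace F] (G : E → F) (hG : ContDiff ℂ 1 G)
    (x : E) (hs : Function.Surjective (fderiv ℂ G x)) : map G (𝓝 x) = 𝓝 (G x) :=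
  (hG.contDiffAt.hasStrictFDerivAt one_ne_zero).map_nhds_eq_of_surj
    (LinearMap.range_eq_top.2 hs)

lemma param_open (G : E8 × E8 → E8) (hG : ContDiff ℂ 1 G)
    (hs : Function.Surjective (fderiv ℂ (fun b => G (0, b)) 0)) :
    ∃ U ∈ 𝓝 (0 : E8), ∃ V ∈ 𝓝 (G (0, 0)), ∀ a ∈ U, ∀ c ∈ V, ∃ b, G (a, b) = c := by
  let H : E8 × E8 → E8 × E8 := fun p => (p.1, G p)
  have hH : ContDiff ℂ 1 H := contDiff_fst.prodMk hG
  have hGd : DifferentiableAt ℂ G (0, 0) := hG.differentiable one_ne_zero _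
  have hHd : HasFDerivAt H ((ContinuousLinearMap.fst ℂ E8 E8).prod (fderiv ℂ G (0, 0))) (0, 0) :=
    hasFDerivAt_fst.prodMk hGd.hasFDerivAt
  have hpart : fderiv ℂ (fun b => G (0, b)) 0
      = (fderiv ℂ G (0, 0)).comp (ContinuousLinearMap.inr ℂ E8 E8) :=
    (hGd.hasFDerivAt.comp (0 : E8) (hasFDerivAt_prodMk_right (0 : E8) (0 : E8))).fderiv
  have hsurj : Function.Surjective (fderiv ℂ H (0, 0)) := by
    rw [hHd.fderiv]
    rintro ⟨u, c⟩
    obtain ⟨b, hb⟩ := hs (c - fderiv ℂ G (0, 0) (u, 0))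
    refine ⟨(u, b), ?_⟩
    rw [hpart] at hb
    simp only [ContinuousLinearMap.comp_apply, ContinuousLinearMap.inr_apply] at hb
    have : ((u, b) : E8 × E8) = (u, 0) + (0, b) := by simp
    ext1
    · simp
    · simp only [ContinuousLinearMap.prod_apply]
      rw [this, map_add, hb]; simp
  have hm := open_of_surj H hH (0, 0) hsurj
  have hr : Set.range H ∈ 𝓝 ((0 : E8), G (0, 0)) := by
    have : Set.range H ∈ map H (𝓝 (0, 0)) := range_mem_map
    rw [hm] at this
    exact this
  rw [nhds_prod_eq, mem_prod_iff] at hr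
  obtain ⟨U, hU, V, hV, hUV⟩ := hr
  refine ⟨U, hU, V, hV, fun a ha c hc => ?_⟩
  obtain ⟨⟨a₂, b⟩, hab⟩ := hUV (Set.mk_mem_prod ha hc)
  have e1 : a₂ = a := congrArg Prod.fst hab
  have e2 : G (a₂, b) = c := congrArg Prod.snd hab
  exact ⟨b, e1 ▸ e2⟩

set_option maxHeartbeats 4000000 in
lemma curves1 : ∀ i j t, G1 (Pi.single j t) i = G1 0 i + t * (J1 i j : ℂ) := by
  intro i j t
  have e : ∀ k : Fin 8, (Pi.single j t : E8) k = if k = j then t else 0 := fun k => by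
    simp [Pi.single_apply]
  simp only [G1, X1, X2, e, Pi.zero_apply, S0_zero, S1_zero, S2_zero, S3_zero, S4_zero,
      S5_zero, S6_zero, S7_zero, mul_one]
  clear e
  fin_cases j <;>
    simp only [Fin.isValue, Fin.reduceFinMk, Fin.reduceEq, if_true, if_false, S0_zero, S1_zero, S2_zero, S3_zero, S4_zero,
      S5_zero, S6_zero, S7_zero, one_mul,
      mul_one, Fin.zero_eta, Fin.mk_one] <;>
    fin_cases i <;>
    simp [baseF, J1, tr3, Matrix.SpecialLinearGroup.coe_mul, Matrix.SpecialLinearGroup.coe_inv,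
      M1_val, M2_val, M3_val,
      S0_val, S1_val, S2_val, S3_val, S4_val, S5_val, S6_val, S7_val,
      Matrix.adjugate_fin_three_of, Matrix.trace_fin_three, -mul_inv_rev,
      -Matrix.cons_mul, Matrix.mul_fin_three] <;>
    try ring1

set_option maxHeartbeats 4000000 in
lemma curves3 : ∀ i j t, G3 (0, Pi.single j t) i = G3 (0, 0) i + t * (J3 i j : ℂ) := by
  intro i j t
  have e : ∀ k : Fin 8, (Pi.single j t : E8) k = if k = j then t else 0 := fun k => by
    simp [Pi.single_apply]
  simp only [G3, X1, X2, X3, e, Pi.zero_apply, S0_zero, S1_zero, S2_zero, S3_zero, S4_zero,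
      S5_zero, S6_zero, S7_zero, mul_one]
  clear e
  fin_cases j <;>
    simp only [Fin.isValue, Fin.reduceFinMk, Fin.reduceEq, if_true, if_false, S0_zero, S1_zero, S2_zero, S3_zero, S4_zero,
      S5_zero, S6_zero, S7_zero, one_mul,
      mul_one, Fin.zero_eta, Fin.mk_one] <;>
    fin_cases i <;>
    simp [nextF, J3, tr3, Matrix.SpecialLinearGroup.coe_mul, Matrix.SpecialLinearGroup.coe_inv,
      M1_val, M2_val, M3_val,
      S0_val, S1_val, S2_val, S3_val, S4_val, S5_val, S6_val, S7_val,
      Matrix.adjugate_fin_three_of, Matrix.trace_fin_three, -mul_inv_rev,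
      -Matrix.cons_mul, Matrix.mul_fin_three] <;>
    try ring1

/-- A polynomial vanishing near a point is zero. -/
lemma poly_zero_of_nhds {σ : Type*} [Fintype σ] (P : MvPolynomial σ ℂ) (x : σ → ℂ)
    (h : ∀ᶠ y in 𝓝 x, MvPolynomial.eval y P = 0) : P = 0 := by
  rw [nhds_pi, eventually_iff, mem_pi] at h
  obtain ⟨I, -, t, ht, hsub⟩ := h
  refine MvPolynomial.funext_set t (fun i => infinite_of_mem_nhds (x i) (ht i)) ?_
  intro y hy
  rw [map_zero]
  exact hsub fun i _ => hy i (Set.mem_univ i)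

theorem trace_functions_algebraically_independent
    (r : ℕ) (hr : 3 ≤ r) :
    AlgebraicIndependent ℂ
      (Sum.elim (fun j : Fin 8 => baseBlock r hr j)
        (fun p : {k : Fin r // 2 ≤ (k : ℕ)} × Fin 8 => fun X : Fin r → SL3 =>
          ![tr3 (X p.1.1),
            tr3 (X p.1.1)⁻¹,
            tr3 (X ⟨0, by omega⟩ * X p.1.1),
            tr3 (X ⟨1, by omega⟩ * X p.1.1),
            tr3 (X ⟨0, by omega⟩ * (X p.1.1)⁻¹),
            tr3 ((X ⟨0, by omega⟩)⁻¹ * (X p.1.1)⁻¹),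
            tr3 ((X ⟨0, by omega⟩)⁻¹ * X p.1.1),
            tr3 ((X ⟨1, by omega⟩)⁻¹ * (X p.1.1)⁻¹)] p.2)) := by
  rw [algebraicIndependent_iff]
  intro P hP
  obtain ⟨U, hU, V, hV, hUV⟩ := param_open G3 smG3
    (surj_of_curves _ ((smG3.comp (contDiff_prodMk_right (0 : E8))).differentiable
      one_ne_zero _) J3 K3 J3K3 curves3)
  have hbase : map G1 (𝓝 0) = 𝓝 (G1 0) :=
    open_of_surj G1 smG1 0
      (surj_of_curves _ (smG1.differentiable one_ne_zero _) J1 K1 J1K1 curves1)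
  have hUb : G1 '' U ∈ 𝓝 (G1 0) := by
    rw [← hbase]; exact image_mem_map hU
  refine poly_zero_of_nhds P (Sum.elim (G1 0) (fun p => G3 (0, 0) p.2)) ?_
  have c1 : Tendsto (fun y : (Fin 8 ⊕ ({k : Fin r // 2 ≤ (k : ℕ)} × Fin 8)) → ℂ =>
      (fun j => y (Sum.inl j) : E8))
      (𝓝 (Sum.elim (G1 0) (fun p => G3 (0, 0) p.2))) (𝓝 (G1 0)) := by
    refine Continuous.tendsto' (by fun_prop) _ _ ?_
    funext j; simp
  have c2 : ∀ k : {k : Fin r // 2 ≤ (k : ℕ)},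
      Tendsto (fun y : (Fin 8 ⊕ ({k : Fin r // 2 ≤ (k : ℕ)} × Fin 8)) → ℂ =>
      (fun j => y (Sum.inr (k, j)) : E8))
      (𝓝 (Sum.elim (G1 0) (fun p => G3 (0, 0) p.2))) (𝓝 (G3 (0, 0))) := by
    intro k
    refine Continuous.tendsto' (by fun_prop) _ _ ?_
    funext j; simp
  filter_upwards [c1 hUb, eventually_all.2 fun k => c2 k hV] with y hy1 hy2
  obtain ⟨a, haU, ha⟩ := hy1
  have hb : ∀ k : {k : Fin r // 2 ≤ (k : ℕ)}, ∃ b, G3 (a, b) = fun j => y (Sum.inr (k, j)) :=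
    fun k => hUV a haU _ (hy2 k)
  choose b hb using hb
  let X : Fin r → SL3 := fun k =>
    if h : 2 ≤ (k : ℕ) then X3 (b ⟨k, h⟩) else if (k : ℕ) = 0 then X1 a else X2 a
  have hX0 : X ⟨0, by omega⟩ = X1 a := by simp [X]
  have hX1 : X ⟨1, by omega⟩ = X2 a := by simp [X]
  have hXk : ∀ k : {k : Fin r // 2 ≤ (k : ℕ)}, X k.1 = X3 (b k) := by
    intro k; simp [X, k.2]
  have hPX := congrFun hP X
  have key : ∀ (v : (Fin 8 ⊕ ({k : Fin r // 2 ≤ (k : ℕ)} × Fin 8)) → (Fin r → SL3) → ℂ),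
      (MvPolynomial.aeval v P) X = MvPolynomial.eval (fun i => v i X) P := by
    intro v
    have h2 : (Pi.evalAlgHom ℂ (fun _ : Fin r → SL3 => ℂ) X).comp (MvPolynomial.aeval v)
        = MvPolynomial.aeval (fun i => v i X) := by
      ext i; simp
    have h3 := DFunLike.congr_fun h2 P
    rw [MvPolynomial.aeval_eq_eval] at h3
    exact h3
  rw [key] at hPX
  rw [Pi.zero_apply] at hPX
  rw [← hPX]
  congr 2
  funext i
  rcases i with j | ⟨k, j⟩
  · refine (congrFun ha j).symm.trans ?_
    simp only [Sum.elim_inl, baseBlock, hX0, hX1]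
    rfl
  · refine (congrFun (hb k) j).symm.trans ?_
    simp only [Sum.elim_inr, hX0, hX1, hXk]
    rfl
end

section
/- The eight functions tr(X₁), tr(X₂), tr(X₁⁻¹), tr(X₂⁻¹), tr(X₁X₂), tr(X₁⁻¹X₂), tr(X₂⁻¹X₁), tr(X₁⁻¹X₂⁻¹) on SL(3,ℂ) × SL(3,ℂ) are algebraically independent over ℂ in the ℂ-algebra of all functions SL(3,ℂ)² → ℂ. -/
lemma aux_quadratic (s m : ℂ) : ∃ x y : ℂ, x + y = s ∧ x * y = m := by
  obtain ⟨d, hd⟩ := IsAlgClosed.exists_pow_nat_eq (s ^ 2 - 4 * m) (n := 2) (by norm_num)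
  refine ⟨(s + d) / 2, (s - d) / 2, by ring, ?_⟩
  linear_combination (-1 / 4) * hd

lemma aux_cubic (a b : ℂ) :
    ∃ x y z : ℂ, x + y + z = a ∧ x * y + x * z + y * z = b ∧ x * y * z = 1 := by
  obtain ⟨x, hx⟩ := IsAlgClosed.exists_root
    (Polynomial.X ^ 3 - Polynomial.C a * Polynomial.X ^ 2 + Polynomial.C b * Polynomial.X
      - Polynomial.C 1 : Polynomial ℂ) (by
      have : (Polynomial.X ^ 3 - Polynomial.C a * Polynomial.X ^ 2
        + Polynomial.C b * Polynomial.X - Polynomial.C 1 : Polynomial ℂ).degree = 3 := by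
        compute_degree!
      rw [this]; norm_num)
  simp only [Polynomial.IsRoot, Polynomial.eval_sub, Polynomial.eval_add, Polynomial.eval_mul,
    Polynomial.eval_pow, Polynomial.eval_X, Polynomial.eval_C] at hx
  obtain ⟨y, z, h1, h2⟩ := aux_quadratic (a - x) (b - x * (a - x))
  refine ⟨x, y, z, by linear_combination h1, by linear_combination x * h1 + h2, ?_⟩
  linear_combination x * h2 + hx

/-- Off-diagonal entries with prescribed two- and three-cycles. -/
lemma aux_cycles (A B C S : ℂ) : ∃ u12 u13 u21 u23 u31 u32 : ℂ,
    u23 * u32 = A ∧ u13 * u31 = B ∧ u12 * u21 = C ∧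
      u12 * u23 * u31 + u13 * u21 * u32 = S := by
  obtain ⟨M, N, h1, h2⟩ := aux_quadratic S (A * B * C)
  have key : ∀ M N : ℂ, M + N = S → M * N = A * B * C → M ≠ 0 →
      ∃ u12 u13 u21 u23 u31 u32 : ℂ,
        u23 * u32 = A ∧ u13 * u31 = B ∧ u12 * u21 = C ∧
          u12 * u23 * u31 + u13 * u21 * u32 = S := by
    intro M N h1 h2 hM
    refine ⟨1, B / M, C, 1, M, A, by ring, by field_simp, by ring, ?_⟩
    field_simp
    linear_combination M * h1 - h2
  by_cases hM : M = 0
  · by_cases hN : N = 0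
    · subst hM hN
      have hS : S = 0 := by linear_combination -h1
      have h : A * B * C = 0 := by linear_combination -h2
      subst hS
      rcases mul_eq_zero.1 h with h | h
      · rcases mul_eq_zero.1 h with h | h
        · subst h; exact ⟨1, 1, C, 0, B, 0, by ring, by ring, by ring, by ring⟩
        · subst h; exact ⟨1, 0, C, 1, 0, A, by ring, by ring, by ring, by ring⟩
      · subst h; exact ⟨0, 1, 0, 1, B, A, by ring, by ring, by ring, by ring⟩
    · exact key N M (by rw [add_comm]; exact h1) (by rw [mul_comm]; exact h2) hN
  · exact key M N h1 h2 hM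

/-- Solving the linear system for a diagonal. -/
lemma aux_linear (x y z : ℂ) (hxy : x - y ≠ 0) (hxz : x - z ≠ 0)
    (hyz : y - z ≠ 0) (c e f : ℂ) : ∃ p q r : ℂ,
      p + q + r = c ∧ x * p + y * q + z * r = e ∧
        y * z * p + x * z * q + x * y * r = f := by
  obtain ⟨m, hm⟩ : ∃ m, m = f + (x + y + z) * e - (x * y + x * z + y * z) * c := ⟨_, rfl⟩
  have hf : f = m - (x + y + z) * e + (x * y + x * z + y * z) * c := by rw [hm]; ring
  subst hf
  have hyx : y - x ≠ 0 := by rw [← neg_sub]; exact neg_ne_zero.2 hxy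
  refine ⟨(m - (y + z) * e + y * z * c) / ((x - y) * (x - z)),
    - (m - (x + z) * e + x * z * c) / ((x - y) * (y - z)),
    (m - (x + y) * e + x * y * c) / ((x - z) * (y - z)), ?_, ?_, ?_⟩
  · field_simp; ring
  · field_simp; ring
  · field_simp; ring

lemma aux_disc (a b : ℤ) (x y z : ℂ) (h1 : x + y + z = ((2 * a : ℤ) : ℂ))
    (h2 : x * y + x * z + y * z = ((2 * b : ℤ) : ℂ)) (h3 : x * y * z = 1) :
    x - y ≠ 0 ∧ x - z ≠ 0 ∧ y - z ≠ 0 := by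
  have hd : ((x - y) * (x - z) * (y - z)) ^ 2 =
      ((2 * (8 * a ^ 2 * b ^ 2 - 16 * b ^ 3 - 16 * a ^ 3 + 36 * a * b - 14) + 1 : ℤ) : ℂ) := by
    have : ((x - y) * (x - z) * (y - z)) ^ 2 =
      (x + y + z) ^ 2 * (x * y + x * z + y * z) ^ 2 - 4 * (x * y + x * z + y * z) ^ 3
       - 4 * (x + y + z) ^ 3 * (x * y * z)
       + 18 * (x + y + z) * (x * y + x * z + y * z) * (x * y * z) - 27 * (x * y * z) ^ 2 := by
      ring
    rw [this, h1, h2, h3]; push_cast; ring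
  have hne : ((x - y) * (x - z) * (y - z)) ^ 2 ≠ 0 := by
    rw [hd]; exact Int.cast_ne_zero.2 (by omega)
  refine ⟨?_, ?_, ?_⟩ <;> intro h <;> apply hne <;> rw [h] <;> ring

lemma aux_surj (a b : ℤ) (c d e f g h : ℂ) : ∃ X : SL3 × SL3,
    tr3 X.1 = ((2 * a : ℤ) : ℂ) ∧ tr3 X.2 = c ∧ tr3 X.1⁻¹ = ((2 * b : ℤ) : ℂ) ∧
    tr3 X.2⁻¹ = d ∧ tr3 (X.1 * X.2) = e ∧ tr3 (X.1⁻¹ * X.2) = f ∧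
    tr3 (X.2⁻¹ * X.1) = g ∧ tr3 (X.1⁻¹ * X.2⁻¹) = h := by
  obtain ⟨x, y, z, h1, h2, h3⟩ := aux_cubic ((2 * a : ℤ) : ℂ) ((2 * b : ℤ) : ℂ)
  obtain ⟨hxy, hxz, hyz⟩ := aux_disc a b x y z h1 h2 h3
  obtain ⟨p, q, r, l1, l2, l3⟩ := aux_linear x y z hxy hxz hyz c e f
  obtain ⟨P, Q, R, k1, k2, k3⟩ := aux_linear x y z hxy hxz hyz d g h
  obtain ⟨u12, u13, u21, u23, u31, u32, c1, c2, c3, c4⟩ :=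
    aux_cycles (q * r - P) (p * r - Q) (p * q - R)
      (1 - p * q * r + p * (q * r - P) + q * (p * r - Q) + r * (p * q - R))
  obtain ⟨X, hX⟩ : ∃ X : SL3, (X : Matrix (Fin 3) (Fin 3) ℂ) = !![x, 0, 0; 0, y, 0; 0, 0, z] := by
    refine ⟨⟨!![x, 0, 0; 0, y, 0; 0, 0, z], ?_⟩, rfl⟩
    rw [Matrix.det_fin_three]; simp; exact h3
  obtain ⟨Y, hY⟩ : ∃ Y : SL3, (Y : Matrix (Fin 3) (Fin 3) ℂ) =
      !![p, u12, u13; u21, q, u23; u31, u32, r] := by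
    refine ⟨⟨!![p, u12, u13; u21, q, u23; u31, u32, r], ?_⟩, rfl⟩
    rw [Matrix.det_fin_three]; simp
    linear_combination c4 - p * c1 - q * c2 - r * c3
  refine ⟨(X, Y), ?_⟩
  · simp only [tr3, Matrix.SpecialLinearGroup.coe_mul, Matrix.SpecialLinearGroup.coe_inv, hX, hY]
    simp [Matrix.adjugate_fin_three, Matrix.trace_fin_three, Matrix.mul_apply, Fin.sum_univ_three]
    push_cast at h1 h2
    refine ⟨?_, ?_, ?_, ?_, ?_, ?_, ?_, ?_⟩
    · linear_combination h1
    · linear_combination l1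
    · linear_combination h2
    · linear_combination k1 - c1 - c2 - c3
    · linear_combination l2
    · linear_combination l3
    · linear_combination k2 - x * c1 - y * c2 - z * c3
    · linear_combination k3 - y * z * c1 - x * z * c2 - x * y * c3

/-- The eight trace functions tr X₁, tr X₂, tr X₁⁻¹, tr X₂⁻¹, tr X₁X₂,
tr X₁⁻¹X₂, tr X₂⁻¹X₁, tr X₁⁻¹X₂⁻¹ on SL(3,ℂ) × SL(3,ℂ) are algebraically
independent over ℂ. -/
theorem eight_trace_functions_algebraically_independent :
    AlgebraicIndependent ℂ
      (fun j : Fin 8 => fun X : SL3 × SL3 =>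
        ![tr3 X.1,
          tr3 X.2,
          tr3 X.1⁻¹,
          tr3 X.2⁻¹,
          tr3 (X.1 * X.2),
          tr3 (X.1⁻¹ * X.2),
          tr3 (X.2⁻¹ * X.1),
          tr3 (X.1⁻¹ * X.2⁻¹)] j) := by
  rw [algebraicIndependent_iff]
  intro P hP
  have hinf : (Set.range (fun n : ℤ => ((2 * n : ℤ) : ℂ))).Infinite := by
    apply Set.infinite_range_of_injective
    intro m n hmn
    have : (2 * m : ℤ) = 2 * n := Int.cast_injective hmn
    omega
  refine MvPolynomial.funext_set (fun _ : Fin 8 => Set.range (fun n : ℤ => ((2 * n : ℤ) : ℂ)))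
    (fun _ => hinf) ?_
  intro v hv
  obtain ⟨a, ha⟩ := hv 0 (Set.mem_univ _)
  obtain ⟨b, hb⟩ := hv 2 (Set.mem_univ _)
  obtain ⟨X, t0, t1, t2, t3, t4, t5, t6, t7⟩ :=
    aux_surj a b (v 1) (v 3) (v 4) (v 5) (v 6) (v 7)
  have hcomp := MvPolynomial.comp_aeval_apply (f := fun j : Fin 8 => fun X : SL3 × SL3 =>
        ![tr3 X.1, tr3 X.2, tr3 X.1⁻¹, tr3 X.2⁻¹, tr3 (X.1 * X.2), tr3 (X.1⁻¹ * X.2),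
          tr3 (X.2⁻¹ * X.1), tr3 (X.1⁻¹ * X.2⁻¹)] j)
    (Pi.evalAlgHom ℂ (fun _ : SL3 × SL3 => ℂ) X) P
  rw [hP, map_zero] at hcomp
  rw [map_zero, hcomp, MvPolynomial.aeval_eq_eval]
  congr 1
  have hveq : v = fun j : Fin 8 => ![tr3 X.1, tr3 X.2, tr3 X.1⁻¹, tr3 X.2⁻¹, tr3 (X.1 * X.2),
      tr3 (X.1⁻¹ * X.2), tr3 (X.2⁻¹ * X.1), tr3 (X.1⁻¹ * X.2⁻¹)] j := by
    rw [t0, t1, t2, t3, t4, t5, t6, t7]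
    funext j
    fin_cases j
    · exact ha.symm
    · rfl
    · exact hb.symm
    all_goals rfl
  exact congrArg _ hveq
end

section
/- There exist polynomials P and Q in eight variables with complex coefficients such that for all X, Y ∈ SL(3,ℂ), tr(XYX⁻¹Y⁻¹)² + P(tr X, tr Y, tr X⁻¹, tr Y⁻¹, tr(XY), tr(X⁻¹Y), tr(Y⁻¹X), tr(X⁻¹Y⁻¹)) · tr(XYX⁻¹Y⁻¹) + Q(tr X, tr Y, tr X⁻¹, tr Y⁻¹, tr(XY), tr(X⁻¹Y), tr(Y⁻¹X), tr(X⁻¹Y⁻¹)) = 0; that is, the function tr(XYX⁻¹Y⁻¹) satisfies a monic degree-2 polynomial relation over the eight algebraically independent trace functions. -/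
/-- Homogenised sum of the two commutator traces in terms of the eight traces. -/
def polyP {R : Type*} [CommRing R] (D E x0 x1 x2 x3 x4 x5 x6 x7 : R) : R :=
  - 3*D*E + x5*x6 + x4*x7 - x2*x3*x4 + D*x1*x3 - x1*x2*x6 - x0*x3*x5 + E*x0*x2 - x0*x1*x7
    + x0*x1*x2*x3

/-- Homogenised product of the two commutator traces in terms of the eight traces. -/
def polyQ {R : Type*} [CommRing R] (D E x0 x1 x2 x3 x4 x5 x6 x7 : R) : R :=
  9*D^2*E^2 + x7^3 + D*x6^3 - 6*D*E*x5*x6 + E*x5^3 - 6*D*E*x4*x7 + x4*x5*x6*x7 + D*E*x4^3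
    - 3*D*x3*x6*x7 + x3*x5^2*x7 + D*x3*x4^2*x6 + D*x3^2*x4*x5 + D^2*x3^3 + x2*x6^2*x7
    - 3*E*x2*x5*x7 + E*x2*x4^2*x5 - 2*x2*x3*x7^2 + 3*D*E*x2*x3*x4 + D*x2*x3^2*x6
    + E*x2^2*x4*x6 + E*x2^2*x3*x5 + x2^2*x3^2*x7 + E^2*x2^3 + x1*x5*x7^2 + D*x1*x4*x6^2
    - 3*D*E*x1*x4*x5 - 6*D^2*E*x1*x3 + D*x1*x3*x5*x6 + D*x1*x3*x4*x7 + 3*D*E*x1*x2*x6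
    - 2*E*x1*x2*x5^2 - x1*x2*x3*x5*x7 - D*x1*x2*x3^2*x4 + E*x1*x2^2*x7 - E*x1*x2^3*x3
    + D*x1^2*x6*x7 + D*E*x1^2*x2*x4 - D*x1^2*x2*x3*x6 + E*x1^2*x2^2*x5 + D^2*E*x1^3
    + x0*x6*x7^2 - 3*D*E*x0*x4*x6 + E*x0*x4*x5^2 - 2*D*x0*x3*x6^2 + 3*D*E*x0*x3*x5
    + D*x0*x3^2*x7 - 6*D*E^2*x0*x2 + E*x0*x2*x5*x6 + E*x0*x2*x4*x7 - x0*x2*x3*x6*x7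
    - D*x0*x2*x3^3 - E*x0*x2^2*x3*x4 + 3*D*E*x0*x1*x7 - 2*D*E*x0*x1*x4^2 - D*x0*x1*x3*x4*x6
    - D*x0*x1*x3^2*x5 - E*x0*x1*x2*x4*x5 + D*E*x0*x1*x2*x3 - E*x0*x1*x2^2*x6 + D*E*x0*x1^2*x5
    - D*x0*x1^2*x3*x7 + D*x0*x1^2*x2*x3^2 - D*E*x0*x1^3*x2 + E*x0^2*x5*x7 + D*E*x0^2*x3*x4
    + D*x0^2*x3^2*x6 - E*x0^2*x2*x3*x5 + D*E*x0^2*x1*x6 - E*x0^2*x1*x2*x7 + E*x0^2*x1*x2^2*x3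
    + D*E*x0^2*x1^2*x4 + D*E^2*x0^3 - D*E*x0^3*x1*x3


open Matrix in
/-- The pair of commutator traces has the prescribed sum and product. -/
def Good (X Y : Matrix (Fin 3) (Fin 3) ℂ) : Prop :=
  trace (X * Y * adjugate X * adjugate Y) + trace (Y * X * adjugate Y * adjugate X)
    = polyP X.det Y.det (trace X) (trace Y) (trace (adjugate X)) (trace (adjugate Y))
        (trace (X * Y)) (trace (adjugate X * Y)) (trace (adjugate Y * X))
        (trace (adjugate X * adjugate Y)) ∧
  trace (X * Y * adjugate X * adjugate Y) * trace (Y * X * adjugate Y * adjugate X)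
    = polyQ X.det Y.det (trace X) (trace Y) (trace (adjugate X)) (trace (adjugate Y))
        (trace (X * Y)) (trace (adjugate X * Y)) (trace (adjugate Y * X))
        (trace (adjugate X * adjugate Y))

theorem det_three_of (a b c d e f g h i : ℂ) :
    Matrix.det !![a, b, c; d, e, f; g, h, i] =
      a * (e * i - f * h) - b * (d * i - f * g) + c * (d * h - e * g) := by
  rw [Matrix.det_fin_three]
  simp
  ring

set_option maxHeartbeats 0 in
set_option maxRecDepth 100000 in
theorem good_caseA (a b c d e f g p q r s w : ℂ) :
    Good !![a, b, c; 0, d, e; 0, f, g] !![0, p, q; 1, r, s; 0, 0, w] := by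
  unfold Good polyP polyQ
  simp only [Matrix.adjugate_fin_three_of, det_three_of, Matrix.mul_fin_three,
    Matrix.trace_fin_three_of, mul_zero, zero_mul, mul_one, one_mul, add_zero, zero_add, sub_zero,
    zero_sub, neg_zero]
  constructor
  · ring
  · ring

set_option maxHeartbeats 0 in
set_option maxRecDepth 100000 in
theorem good_caseC (a b c d e f g q s w : ℂ) :
    Good !![a, b, c; 0, d, e; 0, f, g] !![0, 0, q; 1, 0, s; 0, 1, w] := by
  unfold Good polyP polyQ
  simp only [Matrix.adjugate_fin_three_of, det_three_of, Matrix.mul_fin_three,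
    Matrix.trace_fin_three_of, mul_zero, zero_mul, mul_one, one_mul, add_zero, zero_add, sub_zero,
    zero_sub, neg_zero]
  constructor
  · ring
  · ring

/-- The sum identity for block triangular pairs, in terms of the invariants of the blocks. -/
theorem block_P (a p τ δ σ ε κ : ℂ) :
    (a * p * δ * ε + a * p * (τ ^ 2 * ε + σ ^ 2 * δ + κ ^ 2 - τ * σ * κ - 2 * δ * ε)) +
    (a * p * δ * ε + a * p * (τ ^ 2 * ε + σ ^ 2 * δ + κ ^ 2 - τ * σ * κ - 2 * δ * ε)) =
    polyP (a * δ) (p * ε) (a + τ) (p + σ) (δ + a * τ) (ε + p * σ) (a * p + κ)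
      (δ * p + a * (τ * σ - κ)) (ε * a + p * (τ * σ - κ)) (δ * ε + a * p * κ) := by
  unfold polyP
  ring

set_option maxHeartbeats 0 in
/-- The product identity for block triangular pairs, in terms of the invariants of the blocks. -/
theorem block_Q (a p τ δ σ ε κ : ℂ) :
    (a * p * δ * ε + a * p * (τ ^ 2 * ε + σ ^ 2 * δ + κ ^ 2 - τ * σ * κ - 2 * δ * ε)) *
    (a * p * δ * ε + a * p * (τ ^ 2 * ε + σ ^ 2 * δ + κ ^ 2 - τ * σ * κ - 2 * δ * ε)) =
    polyQ (a * δ) (p * ε) (a + τ) (p + σ) (δ + a * τ) (ε + p * σ) (a * p + κ)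
      (δ * p + a * (τ * σ - κ)) (ε * a + p * (τ * σ - κ)) (δ * ε + a * p * κ) := by
  unfold polyQ
  ring

set_option maxHeartbeats 1000000 in
theorem good_caseB (a b c d e f g p q r s t u w : ℂ) :
    Good !![a, b, c; 0, d, e; 0, f, g] !![p, q, r; 0, s, t; 0, u, w] := by
  have hP := block_P a p (d + g) (d * g - e * f) (s + w) (s * w - t * u)
    (d * s + e * u + f * t + g * w)
  have hQ := block_Q a p (d + g) (d * g - e * f) (s + w) (s * w - t * u)
    (d * s + e * u + f * t + g * w)
  unfold Good
  simp only [Matrix.adjugate_fin_three_of, det_three_of, Matrix.mul_fin_three,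
    Matrix.trace_fin_three_of, mul_zero, zero_mul, add_zero, zero_add, sub_zero, neg_zero]
  constructor
  · convert hP using 2 <;> ring
  · convert hQ using 2 <;> ring


theorem adj_conj (S T X : Matrix (Fin 3) (Fin 3) ℂ) (hST : S * T = 1) :
    Matrix.adjugate (T * X * S) = T * Matrix.adjugate X * S := by
  have hTS : T * S = 1 := mul_eq_one_comm.mp hST
  have hdet : S.det * T.det = 1 := by rw [← Matrix.det_mul, hST, Matrix.det_one]
  have hS : Matrix.adjugate S = S.det • T := by
    calc Matrix.adjugate S = Matrix.adjugate S * (S * T) := by rw [hST, mul_one]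
      _ = S.det • T := by rw [← mul_assoc, Matrix.adjugate_mul]; simp
  have hT : Matrix.adjugate T = T.det • S := by
    calc Matrix.adjugate T = Matrix.adjugate T * (T * S) := by rw [hTS, mul_one]
      _ = T.det • S := by rw [← mul_assoc, Matrix.adjugate_mul]; simp
  rw [Matrix.adjugate_mul_distrib, Matrix.adjugate_mul_distrib, hS, hT]
  simp only [Matrix.smul_mul, Matrix.mul_smul, smul_smul, mul_comm T.det, hdet, one_smul, mul_assoc]

theorem good_of_conj (S T X Y : Matrix (Fin 3) (Fin 3) ℂ) (hST : S * T = 1)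
    (h : Good (T * X * S) (T * Y * S)) : Good X Y := by
  have tc : ∀ M : Matrix (Fin 3) (Fin 3) ℂ, Matrix.trace (T * M * S) = Matrix.trace M := by
    intro M
    rw [Matrix.trace_mul_comm, ← mul_assoc, hST, one_mul]
  have mc : ∀ M N : Matrix (Fin 3) (Fin 3) ℂ, (T * M * S) * (T * N * S) = T * (M * N) * S := by
    intro M N
    calc (T * M * S) * (T * N * S) = T * M * (S * T) * N * S := by simp only [mul_assoc]
      _ = T * (M * N) * S := by rw [hST]; simp only [mul_assoc, one_mul]
  have dc : ∀ M : Matrix (Fin 3) (Fin 3) ℂ, Matrix.det (T * M * S) = Matrix.det M := by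
    intro M
    have hdet : S.det * T.det = 1 := by rw [← Matrix.det_mul, hST, Matrix.det_one]
    rw [Matrix.det_mul, Matrix.det_mul]
    linear_combination M.det * hdet
  unfold Good at h ⊢
  simpa only [adj_conj S T _ hST, mc, tc, dc] using h

/-- Three linearly independent vectors are the columns of an invertible matrix. -/
theorem exists_frame3 (v u w : Fin 3 → ℂ)
    (hw : LinearIndependent ℂ (Fin.snoc ![v, u] w : Fin 3 → Fin 3 → ℂ)) :
    ∃ S T : Matrix (Fin 3) (Fin 3) ℂ, S * T = 1 ∧ S.col 0 = v ∧ S.col 1 = u ∧ S.col 2 = w := by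
  let S : Matrix (Fin 3) (Fin 3) ℂ := (Matrix.of (Fin.snoc ![v, u] w : Fin 3 → Fin 3 → ℂ)).transpose
  have hS : IsUnit S := Matrix.linearIndependent_cols_iff_isUnit.mp hw
  obtain ⟨T, hT⟩ := hS.exists_right_inv
  exact ⟨S, T, hT, rfl, rfl, rfl⟩

/-- Two linearly independent vectors are the first two columns of an invertible matrix. -/
theorem exists_frame (v u : Fin 3 → ℂ) (h : LinearIndependent ℂ ![v, u]) :
    ∃ S T : Matrix (Fin 3) (Fin 3) ℂ, S * T = 1 ∧ S.col 0 = v ∧ S.col 1 = u := by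
  obtain ⟨w, hw⟩ := exists_linearIndependent_snoc_of_lt_finrank h (by simp)
  obtain ⟨S, T, hST, h0, h1, -⟩ := exists_frame3 v u w hw
  exact ⟨S, T, hST, h0, h1⟩

theorem conj_col (S T X : Matrix (Fin 3) (Fin 3) ℂ) (i j : Fin 3) :
    (T * X * S) i j = (T.mulVec (X.mulVec (S.col j))) i := by
  rw [Matrix.mulVec_mulVec]
  rfl

theorem good_all (X Y : Matrix (Fin 3) (Fin 3) ℂ) : Good X Y := by
  obtain ⟨a, ha⟩ := Module.End.exists_eigenvalue (Matrix.toLin' X)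
  obtain ⟨v, hv⟩ := ha.exists_hasEigenvector
  have hXv : X.mulVec v = a • v := by simpa using hv.apply_eq_smul
  have hv0 : v ≠ 0 := hv.2
  have key : ∀ S T : Matrix (Fin 3) (Fin 3) ℂ, S * T = 1 → ∀ i j, T.mulVec (S.col j) i =
      (1 : Matrix (Fin 3) (Fin 3) ℂ) i j := by
    intro S T hST i j
    rw [← mul_eq_one_comm.mp hST]
    rfl
  by_cases hY : ∃ μ : ℂ, μ • v = Y.mulVec v
  · obtain ⟨μ, hμ⟩ := hY
    obtain ⟨u, hu⟩ := exists_linearIndependent_pair_of_one_lt_finrank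
      (R := ℂ) (M := Fin 3 → ℂ) (by simp) hv0
    obtain ⟨S, T, hST, h0, h1⟩ := exists_frame v u hu
    apply good_of_conj S T X Y hST
    have k := key S T hST
    have hA : ∀ i, (T * X * S) i 0 = a * (1 : Matrix (Fin 3) (Fin 3) ℂ) i 0 := by
      intro i
      rw [conj_col, h0, hXv, Matrix.mulVec_smul, ← h0, Pi.smul_apply, k, smul_eq_mul]
    have hB : ∀ i, (T * Y * S) i 0 = μ * (1 : Matrix (Fin 3) (Fin 3) ℂ) i 0 := by
      intro i
      rw [conj_col, h0, ← hμ, Matrix.mulVec_smul, ← h0, Pi.smul_apply, k, smul_eq_mul]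
    rw [Matrix.eta_fin_three (T * X * S), Matrix.eta_fin_three (T * Y * S), hA 1, hA 2, hB 1, hB 2]
    simp only [Matrix.one_apply_ne (show (1 : Fin 3) ≠ 0 by decide),
      Matrix.one_apply_ne (show (2 : Fin 3) ≠ 0 by decide), mul_zero]
    apply good_caseB
  · push Not at hY
    have hu := (LinearIndependent.pair_iff' hv0).mpr hY
    by_cases hmem : Y.mulVec (Y.mulVec v) ∈ Submodule.span ℂ {v, Y.mulVec v}
    · obtain ⟨p, r, hpr⟩ := Submodule.mem_span_pair.mp hmem
      obtain ⟨S, T, hST, h0, h1⟩ := exists_frame v _ hu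
      apply good_of_conj S T X Y hST
      have k := key S T hST
      have hA : ∀ i, (T * X * S) i 0 = a * (1 : Matrix (Fin 3) (Fin 3) ℂ) i 0 := by
        intro i
        rw [conj_col, h0, hXv, Matrix.mulVec_smul, ← h0, Pi.smul_apply, k, smul_eq_mul]
      have hB : ∀ i, (T * Y * S) i 0 = (1 : Matrix (Fin 3) (Fin 3) ℂ) i 1 := by
        intro i
        rw [conj_col, h0, ← h1, k]
      have hC : ∀ i, (T * Y * S) i 1 = p * (1 : Matrix (Fin 3) (Fin 3) ℂ) i 0 +
          r * (1 : Matrix (Fin 3) (Fin 3) ℂ) i 1 := by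
        intro i
        rw [conj_col, h1, ← hpr, ← h1, ← h0, Matrix.mulVec_add, Matrix.mulVec_smul,
          Matrix.mulVec_smul, Pi.add_apply, Pi.smul_apply, Pi.smul_apply, k, k, smul_eq_mul,
          smul_eq_mul]
      rw [Matrix.eta_fin_three (T * X * S), Matrix.eta_fin_three (T * Y * S), hA 1, hA 2,
        hB 0, hB 1, hB 2, hC 2]
      simp only [Matrix.one_apply_ne (show (1 : Fin 3) ≠ 0 by decide),
        Matrix.one_apply_ne (show (2 : Fin 3) ≠ 0 by decide),
        Matrix.one_apply_ne (show (0 : Fin 3) ≠ 1 by decide),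
        Matrix.one_apply_ne (show (2 : Fin 3) ≠ 1 by decide),  Matrix.one_apply_eq, mul_zero, add_zero]
      apply good_caseA
    · obtain ⟨S, T, hST, h0, h1, h2⟩ := exists_frame3 v _ (Y.mulVec (Y.mulVec v))
        (linearIndependent_finSnoc.mpr ⟨hu, by simpa [Set.pair_comm] using hmem⟩)
      apply good_of_conj S T X Y hST
      have k := key S T hST
      have hA : ∀ i, (T * X * S) i 0 = a * (1 : Matrix (Fin 3) (Fin 3) ℂ) i 0 := by
        intro i
        rw [conj_col, h0, hXv, Matrix.mulVec_smul, ← h0, Pi.smul_apply, k, smul_eq_mul]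
      have hB : ∀ i, (T * Y * S) i 0 = (1 : Matrix (Fin 3) (Fin 3) ℂ) i 1 := by
        intro i
        rw [conj_col, h0, ← h1, k]
      have hC : ∀ i, (T * Y * S) i 1 = (1 : Matrix (Fin 3) (Fin 3) ℂ) i 2 := by
        intro i
        rw [conj_col, h1, ← h2, k]
      rw [Matrix.eta_fin_three (T * X * S), Matrix.eta_fin_three (T * Y * S), hA 1, hA 2,
        hB 0, hB 1, hB 2, hC 0, hC 1, hC 2]
      simp only [Matrix.one_apply_ne (show (1 : Fin 3) ≠ 0 by decide),
        Matrix.one_apply_ne (show (2 : Fin 3) ≠ 0 by decide),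
        Matrix.one_apply_ne (show (0 : Fin 3) ≠ 1 by decide),
        Matrix.one_apply_ne (show (2 : Fin 3) ≠ 1 by decide), Matrix.one_apply_ne (show (0 : Fin 3) ≠ 2 by decide),
        Matrix.one_apply_ne (show (1 : Fin 3) ≠ 2 by decide),
        Matrix.one_apply_eq, mul_zero]
      apply good_caseC

theorem eval_polyP (z : Fin 8 → ℂ) :
    MvPolynomial.eval z (polyP 1 1 (.X 0) (.X 1) (.X 2) (.X 3) (.X 4) (.X 5) (.X 6) (.X 7)) =
      polyP 1 1 (z 0) (z 1) (z 2) (z 3) (z 4) (z 5) (z 6) (z 7) := by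
  unfold polyP
  simp only [map_add, map_sub, map_neg, map_mul, map_one, map_ofNat, MvPolynomial.eval_X]

theorem eval_polyQ (z : Fin 8 → ℂ) :
    MvPolynomial.eval z (polyQ 1 1 (.X 0) (.X 1) (.X 2) (.X 3) (.X 4) (.X 5) (.X 6) (.X 7)) =
      polyQ 1 1 (z 0) (z 1) (z 2) (z 3) (z 4) (z 5) (z 6) (z 7) := by
  unfold polyQ
  simp only [map_add, map_sub, map_mul, map_pow, map_one, map_ofNat, MvPolynomial.eval_X]

/-- The commutator trace tr(XYX⁻¹Y⁻¹) satisfies a monic degree-2 polynomial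
relation over the eight trace functions tr X, tr Y, tr X⁻¹, tr Y⁻¹, tr XY,
tr X⁻¹Y, tr Y⁻¹X, tr X⁻¹Y⁻¹. -/
theorem commutator_trace_monic_degree_two_relation :
    ∃ P Q : MvPolynomial (Fin 8) ℂ,
      ∀ X Y : SL3,
        tr3 (X * Y * X⁻¹ * Y⁻¹) ^ 2
          + MvPolynomial.eval
              (![tr3 X, tr3 Y, tr3 X⁻¹, tr3 Y⁻¹, tr3 (X * Y), tr3 (X⁻¹ * Y),
                 tr3 (Y⁻¹ * X), tr3 (X⁻¹ * Y⁻¹)]) P * tr3 (X * Y * X⁻¹ * Y⁻¹)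
          + MvPolynomial.eval
              (![tr3 X, tr3 Y, tr3 X⁻¹, tr3 Y⁻¹, tr3 (X * Y), tr3 (X⁻¹ * Y),
                 tr3 (Y⁻¹ * X), tr3 (X⁻¹ * Y⁻¹)]) Q = 0 := by
  refine ⟨-polyP 1 1 (.X 0) (.X 1) (.X 2) (.X 3) (.X 4) (.X 5) (.X 6) (.X 7),
    polyQ 1 1 (.X 0) (.X 1) (.X 2) (.X 3) (.X 4) (.X 5) (.X 6) (.X 7), ?_⟩
  intro X Y
  obtain ⟨hP, hQ⟩ := good_all X.1 Y.1
  rw [X.2, Y.2] at hP hQ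
  rw [map_neg, eval_polyP, eval_polyQ]
  simp only [tr3, Matrix.SpecialLinearGroup.coe_mul, Matrix.SpecialLinearGroup.coe_inv]
  set c := Matrix.trace (X.1 * Y.1 * X.1.adjugate * Y.1.adjugate)
  refine Eq.trans (b := c ^ 2 - polyP 1 1 X.1.trace Y.1.trace X.1.adjugate.trace
    Y.1.adjugate.trace (X.1 * Y.1).trace (X.1.adjugate * Y.1).trace (Y.1.adjugate * X.1).trace
    (X.1.adjugate * Y.1.adjugate).trace * c + polyQ 1 1 X.1.trace Y.1.trace X.1.adjugate.trace
    Y.1.adjugate.trace (X.1 * Y.1).trace (X.1.adjugate * Y.1).trace (Y.1.adjugate * X.1).trace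
    (X.1.adjugate * Y.1.adjugate).trace) ?_ ?_
  · rw [sub_eq_add_neg, ← neg_mul]
    rfl
  · rw [← hP, ← hQ]
    ring
end

section
/- The function (X,Y) ↦ tr(XYX⁻¹Y⁻¹) on SL(3,ℂ) × SL(3,ℂ) does not lie in the ℂ-subalgebra of functions SL(3,ℂ)² → ℂ generated by the eight functions tr(X), tr(Y), tr(X⁻¹), tr(Y⁻¹), tr(XY), tr(X⁻¹Y), tr(Y⁻¹X), tr(X⁻¹Y⁻¹); that is, tr(XYX⁻¹Y⁻¹) is not a polynomial in the other eight generators. -/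
/-- The witness `X`. -/
def wX : SL3 := ⟨!![1, 0, 0; 0, 0, -1; 0, 1, 0], by simp [Matrix.det_fin_three]⟩
/-- The witness `Y`. -/
def wY : SL3 := ⟨!![0, 0, -1; -1, 0, 0; 1, 1, 0], by simp [Matrix.det_fin_three]⟩

lemma tr3_transpose (X : SL3) : tr3 X.transpose = tr3 X := by
  simp [tr3, Matrix.trace_transpose]

lemma tr3_mul_comm (X Y : SL3) : tr3 (X * Y) = tr3 (Y * X) := by
  simp only [tr3, Matrix.SpecialLinearGroup.coe_mul]
  exact Matrix.trace_mul_comm _ _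

lemma transpose_mul_SL3 (X Y : SL3) : X.transpose * Y.transpose = (Y * X).transpose := by
  apply Subtype.ext
  simp [Matrix.transpose_mul]

lemma transpose_inv_SL3 (X : SL3) : X.transpose⁻¹ = X⁻¹.transpose := by
  rw [inv_eq_iff_mul_eq_one, transpose_mul_SL3, inv_mul_cancel]
  apply Subtype.ext
  simp

/-- The commutator trace (X,Y) ↦ tr(XYX⁻¹Y⁻¹) is not in the ℂ-subalgebra of
functions SL(3,ℂ)² → ℂ generated by the eight trace functions tr X, tr Y,
tr X⁻¹, tr Y⁻¹, tr XY, tr X⁻¹Y, tr Y⁻¹X, tr X⁻¹Y⁻¹. -/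
theorem commutator_trace_not_in_adjoin :
    (fun X : SL3 × SL3 => tr3 (X.1 * X.2 * X.1⁻¹ * X.2⁻¹)) ∉
      Algebra.adjoin ℂ
        ({fun X : SL3 × SL3 => tr3 X.1,
          fun X : SL3 × SL3 => tr3 X.2,
          fun X : SL3 × SL3 => tr3 X.1⁻¹,
          fun X : SL3 × SL3 => tr3 X.2⁻¹,
          fun X : SL3 × SL3 => tr3 (X.1 * X.2),
          fun X : SL3 × SL3 => tr3 (X.1⁻¹ * X.2),
          fun X : SL3 × SL3 => tr3 (X.2⁻¹ * X.1),
          fun X : SL3 × SL3 => tr3 (X.1⁻¹ * X.2⁻¹)} :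
          Set ((SL3 × SL3) → ℂ)) := by
  intro h
  have e := Algebra.adjoin_induction
      (p := fun f _ => f (wX, wY) = f (wX.transpose, wY.transpose)) ?_ ?_ ?_ ?_ h
  rotate_left
  · rintro g (rfl | rfl | rfl | rfl | rfl | rfl | rfl | rfl) <;>
      simp only [transpose_inv_SL3, transpose_mul_SL3, tr3_transpose]
    all_goals exact tr3_mul_comm _ _
  · intro r
    rfl
  · intro f g _ _ hf hg
    simp only [Pi.add_apply, hf, hg]
  · intro f g _ _ hf hg
    simp only [Pi.mul_apply, hf, hg]
  simp only [transpose_inv_SL3, transpose_mul_SL3, tr3_transpose] at e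
  have hX : (wX : Matrix (Fin 3) (Fin 3) ℂ) = !![1, 0, 0; 0, 0, -1; 0, 1, 0] := rfl
  have hY : (wY : Matrix (Fin 3) (Fin 3) ℂ) = !![0, 0, -1; -1, 0, 0; 1, 1, 0] := rfl
  simp only [tr3, Matrix.SpecialLinearGroup.coe_mul, Matrix.SpecialLinearGroup.coe_inv,
    hX, hY, Matrix.adjugate_fin_three_of] at e
  norm_num [Matrix.trace_fin_three, Matrix.mul_apply, Fin.sum_univ_three] at e
  change (1 + 0 : ℂ) = -1 + 0 at e
  norm_num at e
end

section
/- Every conjugation-invariant polynomial function on SL(3,ℂ) × SL(3,ℂ) lies in the ℂ-subalgebra of functions SL(3,ℂ)² → ℂ generated by the nine functions tr(X₁), tr(X₂), tr(X₁X₂), tr(X₁⁻¹), tr(X₂⁻¹), tr(X₁X₂⁻¹), tr(X₂X₁⁻¹), tr(X₁⁻¹X₂⁻¹), tr(X₁X₂X₁⁻¹X₂⁻¹); that is, every such invariant is a polynomial in these nine trace functions. -/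
section TracePart
set_option linter.unusedSectionVars false
set_option linter.unusedSimpArgs false
set_option linter.unnecessarySimpa false
open Matrix

theorem ch_quad {F : Type*} [CommRing F] (A : Matrix (Fin 3) (Fin 3) F) :
    A * A = A.trace • A - A.adjugate.trace • 1 + A.adjugate := by
  ext i j
  fin_cases i <;> fin_cases j <;>
  simp [Matrix.mul_apply, Fin.sum_univ_three, Matrix.trace, Matrix.adjugate_fin_three] <;> ring

theorem ch_pol {F : Type*} [CommRing F] (A B : Matrix (Fin 3) (Fin 3) F) :
    A * B * A = -(A.adjugate * B) - B * A.adjugate + A.adjugate.trace • B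
      + B.trace • A.adjugate + (A * B).trace • A
      + ((A.adjugate * B).trace - A.adjugate.trace * B.trace) • 1 := by
  ext i j
  fin_cases i <;> fin_cases j <;>
  simp [Matrix.mul_apply, Fin.sum_univ_three, Matrix.trace, Matrix.adjugate_fin_three,
    Matrix.vecMul, dotProduct] <;> ring

variable {F : Type*} [CommRing F] [Algebra ℂ F]

/-- Letters: generator and sign. -/
abbrev Letter := Bool × Bool

def Letter.inv (a : Letter) : Letter := (a.1, !a.2)

/-- Matrix of a letter. -/
noncomputable def letterMat (x : Bool → SpecialLinearGroup (Fin 3) F) (a : Letter) :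
    Matrix (Fin 3) (Fin 3) F :=
  if a.2 then (x a.1 : Matrix (Fin 3) (Fin 3) F) else (x a.1 : Matrix (Fin 3) (Fin 3) F).adjugate

noncomputable def wordMat (x : Bool → SpecialLinearGroup (Fin 3) F) (l : List Letter) :
    Matrix (Fin 3) (Fin 3) F := (l.map (letterMat x)).prod

variable (x : Bool → SpecialLinearGroup (Fin 3) F)

theorem wordMat_append (l m : List Letter) :
    wordMat x (l ++ m) = wordMat x l * wordMat x m := by
  simp [wordMat]

theorem wordMat_cons (a : Letter) (m : List Letter) :
    wordMat x (a :: m) = letterMat x a * wordMat x m := by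
  simp [wordMat]

theorem wordMat_nil : wordMat x [] = 1 := by
  simp [wordMat]

theorem letterMat_inv (a : Letter) : letterMat x a.inv = (letterMat x a).adjugate := by
  obtain ⟨g, s⟩ := a
  cases s
  · simp [letterMat, Letter.inv, Matrix.adjugate_adjugate]
  · simp [letterMat, Letter.inv]

theorem letterMat_det (a : Letter) : (letterMat x a).det = 1 := by
  obtain ⟨g, s⟩ := a
  cases s
  · simp [letterMat, Matrix.det_adjugate]
  · simp [letterMat]

theorem letterMat_mul_inv (a : Letter) : letterMat x a * letterMat x a.inv = 1 := by
  rw [letterMat_inv, Matrix.mul_adjugate, letterMat_det, one_smul]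

theorem letterMat_inv_mul (a : Letter) : letterMat x a.inv * letterMat x a = 1 := by
  rw [letterMat_inv, Matrix.adjugate_mul, letterMat_det, one_smul]

theorem word_rot (l m : List Letter) :
    (wordMat x (l ++ m)).trace = (wordMat x (m ++ l)).trace := by
  rw [wordMat_append, wordMat_append, Matrix.trace_mul_comm]

theorem letter_sq (a : Letter) : letterMat x a * letterMat x a =
    (letterMat x a).trace • letterMat x a - (letterMat x a.inv).trace • 1 + letterMat x a.inv := by
  rw [letterMat_inv]; exact ch_quad _

theorem letter_pol (a : Letter) (B : Matrix (Fin 3) (Fin 3) F) :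
    letterMat x a * B * letterMat x a =
      -(letterMat x a.inv * B) - B * letterMat x a.inv + (letterMat x a.inv).trace • B
      + B.trace • letterMat x a.inv + (letterMat x a * B).trace • letterMat x a
      + ((letterMat x a.inv * B).trace - (letterMat x a.inv).trace * B.trace) • 1 := by
  rw [letterMat_inv]; exact ch_pol _ _

variable (R : Subalgebra ℂ F)
  (h1 : ∀ a : Letter, (letterMat x a).trace ∈ R)
  (h2 : ∀ a b : Letter, a.1 ≠ b.1 → (letterMat x a * letterMat x b).trace ∈ R)
  (h4 : (wordMat x [(true, true), (false, true), (true, false), (false, false)]).trace ∈ R)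

include h1 in
theorem red_pair (l r : List Letter) (a b : Letter) (hab : a.1 = b.1)
    (ih : ∀ m : List Letter, m.length < (l ++ a :: b :: r).length → (wordMat x m).trace ∈ R) :
    (wordMat x (l ++ a :: b :: r)).trace ∈ R := by
  have hb : b = a ∨ b = a.inv := by
    obtain ⟨g, s⟩ := a; obtain ⟨g', s'⟩ := b
    revert hab; cases g <;> cases g' <;> cases s <;> cases s' <;> simp [Letter.inv]
  rcases hb with rfl | rfl
  · have e : (wordMat x (l ++ b :: b :: r)).trace =
        (letterMat x b).trace * (wordMat x (l ++ b :: r)).trace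
        - (letterMat x b.inv).trace * (wordMat x (l ++ r)).trace
        + (wordMat x (l ++ b.inv :: r)).trace := by
      simp only [wordMat_append, wordMat_cons]
      rw [← mul_assoc (letterMat x b), letter_sq]
      simp [mul_add, add_mul, mul_sub, sub_mul, Matrix.trace_add, Matrix.trace_sub, mul_assoc]
    rw [e]
    exact add_mem (sub_mem (mul_mem (h1 _) (ih _ (by simp)))
      (mul_mem (h1 _) (ih _ (by simp)))) (ih _ (by simp))
  · have e : wordMat x (l ++ a :: a.inv :: r) = wordMat x (l ++ r) := by
      simp only [wordMat_append, wordMat_cons]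
      rw [← mul_assoc (letterMat x a), letterMat_mul_inv, one_mul]
    rw [e]
    exact ih _ (by simp)

theorem letter_inv_fst (a : Letter) : a.inv.1 = a.1 := rfl

include h1 h2 in
theorem red_triple (l r : List Letter) (a b : Letter) (hab : a.1 ≠ b.1)
    (ih : ∀ m : List Letter, m.length < (l ++ a :: b :: a :: r).length → (wordMat x m).trace ∈ R) :
    (wordMat x (l ++ a :: b :: a :: r)).trace ∈ R := by
  have e : (wordMat x (l ++ a :: b :: a :: r)).trace =
      -(wordMat x (l ++ a.inv :: b :: r)).trace - (wordMat x (l ++ b :: a.inv :: r)).trace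
      + (letterMat x a.inv).trace * (wordMat x (l ++ b :: r)).trace
      + (letterMat x b).trace * (wordMat x (l ++ a.inv :: r)).trace
      + (letterMat x a * letterMat x b).trace * (wordMat x (l ++ a :: r)).trace
      + ((letterMat x a.inv * letterMat x b).trace - (letterMat x a.inv).trace * (letterMat x b).trace)
        * (wordMat x (l ++ r)).trace := by
    simp only [wordMat_append, wordMat_cons]
    rw [← mul_assoc (letterMat x b), ← mul_assoc (letterMat x a), ← mul_assoc (letterMat x a),
      letter_pol]
    simp only [mul_add, add_mul, mul_sub, sub_mul, Matrix.trace_add, Matrix.trace_sub, mul_assoc,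
      Matrix.trace_neg, mul_neg, neg_mul, Matrix.smul_mul, Matrix.mul_smul, Matrix.trace_smul,
      smul_eq_mul, one_mul, sub_smul, Matrix.trace_smul]
  rw [e]
  have i1 := h2 a.inv b hab
  have i2 := h2 a b hab
  refine add_mem (add_mem (add_mem (add_mem (sub_mem (neg_mem ?_) ?_) (mul_mem (h1 _) ?_))
    (mul_mem (h1 _) ?_)) (mul_mem i2 ?_)) (mul_mem (sub_mem i1 (mul_mem (h1 _) (h1 _))) ?_) <;>
  exact ih _ (by simp only [List.length_append, List.length_cons]; omega)

theorem letter_cases (a b c : Letter) : a.1 = b.1 ∨ b.1 = c.1 ∨ (a.1 ≠ b.1 ∧ c = a) ∨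
    (c = a.inv ∧ b.1 ≠ a.1) := by
  revert a b c; unfold Letter.inv; decide

include h1 h2 in
/-- Either a triple is alternating or the word is reducible. -/
theorem red_any (l r : List Letter) (a b c : Letter)
    (ih : ∀ m : List Letter, m.length < (l ++ a :: b :: c :: r).length → (wordMat x m).trace ∈ R) :
    (wordMat x (l ++ a :: b :: c :: r)).trace ∈ R ∨ (c = a.inv ∧ b.1 ≠ a.1) := by
  rcases letter_cases a b c with h | h | h | h
  · exact Or.inl (red_pair x R h1 l _ a b h ih)
  · left
    have := red_pair x R h1 (l ++ [a]) r b c h (by simpa using ih)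
    simpa using this
  · obtain ⟨h, rfl⟩ := h
    exact Or.inl (red_triple x R h1 h2 l _ c b h ih)
  · exact Or.inr h

theorem letter_cover (a : Letter) : a = (true, true) ∨ a = (true, false) ∨ a = (false, true) ∨
   a = (false, false) := by
  revert a; decide

include h1 h2 in
theorem small_words (l : List Letter) (hl : l.length < 4) : (wordMat x l).trace ∈ R := by
  induction hn : l.length using Nat.strong_induction_on generalizing l with
  | _ n IH =>
    have ih : ∀ m : List Letter, m.length < l.length → (wordMat x m).trace ∈ R := by
      intro m hm
      exact IH m.length (hn ▸ hm) m (by omega) rfl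
    match l, hl, ih with
    | [], _, _ =>
      rw [wordMat_nil]; simpa using natCast_mem R 3
    | [a], _, _ => simpa [wordMat] using h1 a
    | [a, b], _, ih =>
      by_cases hab : a.1 = b.1
      · exact red_pair x R h1 [] [] a b hab ih
      · simpa [wordMat] using h2 a b hab
    | [a, b, c], _, ih =>
      rcases red_any x R h1 h2 [] [] a b c ih with h | ⟨rfl, h⟩
      · exact h
      · have := red_pair x R h1 [] [b] a.inv a rfl ih
        rw [show [a, b, a.inv] = [a, b] ++ [a.inv] from rfl, word_rot]
        exact this

include h1 h2 h4 in
theorem comm_inv_word :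
    (wordMat x [(false, true), (true, true), (false, false), (true, false)]).trace ∈ R := by
  have sm := small_words x R h1 h2
  set a : Letter := (true, true) with ha
  set b : Letter := (false, true) with hb
  have e1 : (true, false) = a.inv := rfl
  have e2 : (false, false) = b.inv := rfl
  rw [e1, e2] at *
  -- trace of a * (a b a) * b⁻¹, in two ways
  have k1 : (wordMat x [a, a, b, a, b.inv]).trace =
        (letterMat x a).trace * (wordMat x [a, b, a, b.inv]).trace
        - (letterMat x a.inv).trace * (wordMat x [b, a, b.inv]).trace
        + (wordMat x [a.inv, b, a, b.inv]).trace := by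
    rw [wordMat_cons, wordMat_cons, ← mul_assoc, letter_sq]
    simp only [mul_add, add_mul, mul_sub, sub_mul, Matrix.trace_add, Matrix.trace_sub, mul_assoc,
      Matrix.smul_mul, Matrix.trace_smul, smul_eq_mul, one_mul, wordMat_cons]
  have k2 : (wordMat x [a, a, b, a, b.inv]).trace =
      -(wordMat x [b, b.inv]).trace - (wordMat x [a, b, a.inv, b.inv]).trace
      + (letterMat x a.inv).trace * (wordMat x [a, b, b.inv]).trace
      + (letterMat x b).trace * (wordMat x [b.inv]).trace
      + (letterMat x a * letterMat x b).trace * (wordMat x [a, a, b.inv]).trace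
      + ((letterMat x a.inv * letterMat x b).trace - (letterMat x a.inv).trace * (letterMat x b).trace)
        * (wordMat x [a, b.inv]).trace := by
    have e3 : wordMat x [b.inv] = wordMat x [a, a.inv, b.inv] := by
      rw [wordMat_cons, wordMat_cons x a, wordMat_cons x a.inv, ← mul_assoc, letterMat_mul_inv,
        one_mul, wordMat_cons]
    have e4 : wordMat x [b, b.inv] = wordMat x [a, a.inv, b, b.inv] := by
      rw [wordMat_cons x a, wordMat_cons x a.inv, ← mul_assoc, letterMat_mul_inv, one_mul]
    rw [e3, e4]
    rw [wordMat_cons, wordMat_cons, wordMat_cons, wordMat_cons,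
      ← mul_assoc (letterMat x b), ← mul_assoc (letterMat x a) (_ * _),
      ← mul_assoc (letterMat x a) (letterMat x b), letter_pol]
    simp only [mul_add, add_mul, mul_sub, sub_mul, Matrix.trace_add, Matrix.trace_sub, mul_assoc,
      Matrix.trace_neg, mul_neg, neg_mul, Matrix.smul_mul, Matrix.mul_smul, Matrix.trace_smul,
      smul_eq_mul, one_mul, sub_smul, Matrix.trace_smul, wordMat_cons]
  have k3 : (wordMat x [a, b, a, b.inv]).trace ∈ R := by
    refine red_triple x R h1 h2 [] [b.inv] a b (by decide) ?_
    intro m hm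
    exact sm m (by simpa using hm)
  have k4 : (wordMat x [b, a, b.inv, a.inv]).trace = (wordMat x [a.inv, b, a, b.inv]).trace :=
    word_rot x [b, a, b.inv] [a.inv]
  have k5 : (wordMat x [b, a, b.inv, a.inv]).trace =
     (-(wordMat x [b, b.inv]).trace - (wordMat x [a, b, a.inv, b.inv]).trace
      + (letterMat x a.inv).trace * (wordMat x [a, b, b.inv]).trace
      + (letterMat x b).trace * (wordMat x [b.inv]).trace
      + (letterMat x a * letterMat x b).trace * (wordMat x [a, a, b.inv]).trace
      + ((letterMat x a.inv * letterMat x b).trace - (letterMat x a.inv).trace * (letterMat x b).trace)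
        * (wordMat x [a, b.inv]).trace)
      - ((letterMat x a).trace * (wordMat x [a, b, a, b.inv]).trace
        - (letterMat x a.inv).trace * (wordMat x [b, a, b.inv]).trace) := by
    rw [k4]; linear_combination k2 - k1
  rw [k5]
  have i1 := h2 a.inv b (by decide)
  have i2 := h2 a b (by decide)
  refine sub_mem (add_mem (add_mem (add_mem (add_mem (sub_mem (neg_mem (sm _ (by simp))) h4)
    (mul_mem (h1 _) (sm _ (by simp)))) (mul_mem (h1 _) (sm _ (by simp))))
    (mul_mem i2 (sm _ (by simp)))) (mul_mem (sub_mem i1 (mul_mem (h1 _) (h1 _))) (sm _ (by simp))))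
    (sub_mem (mul_mem (h1 _) k3) (mul_mem (h1 _) (sm _ (by simp))))

include h1 h2 h4 in
theorem comm_words (a b : Letter) (hab : b.1 ≠ a.1) :
    (wordMat x [a, b, a.inv, b.inv]).trace ∈ R := by
  have h4' := comm_inv_word x R h1 h2 h4
  have rot : ∀ p q r s : Letter, (wordMat x [p, q, r, s]).trace = (wordMat x [q, r, s, p]).trace :=
    fun p q r s => word_rot x [p] [q, r, s]
  have aux : ∀ p q r s : Letter, (wordMat x [p, q, r, s]).trace ∈ R →
      (wordMat x [p, q, r, s]).trace ∈ R ∧ (wordMat x [q, r, s, p]).trace ∈ R ∧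
      (wordMat x [r, s, p, q]).trace ∈ R ∧ (wordMat x [s, p, q, r]).trace ∈ R := by
    intro p q r s h
    have r1 := rot p q r s
    have r2 := rot q r s p
    have r3 := rot r s p q
    refine ⟨h, r1 ▸ h, (r1.trans r2) ▸ h, ((r1.trans r2).trans r3) ▸ h⟩
  obtain ⟨c1, c2, c3, c4⟩ := aux _ _ _ _ h4
  obtain ⟨d1, d2, d3, d4⟩ := aux _ _ _ _ h4'
  rcases letter_cover a with rfl | rfl | rfl | rfl <;> rcases letter_cover b with rfl | rfl | rfl | rfl <;>
  first
  | exact absurd rfl hab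
  | assumption

theorem letter_inv_inv (a : Letter) : a.inv.inv = a := by
  simp [Letter.inv]

theorem word_det (l : List Letter) : (wordMat x l).det = 1 := by
  induction l with
  | nil => simp [wordMat_nil]
  | cons a l ih => rw [wordMat_cons, Matrix.det_mul, ih, letterMat_det, one_mul]

theorem word_four_adj (a b : Letter) :
    (wordMat x [a, b, a.inv, b.inv]).adjugate = wordMat x [b, a, b.inv, a.inv] := by
  simp only [wordMat_cons, wordMat_nil, Matrix.adjugate_mul_distrib, ← letterMat_inv, letter_inv_inv,
    mul_one, mul_assoc]

include h1 h2 h4 in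
theorem all_words (l : List Letter) : (wordMat x l).trace ∈ R := by
  induction hn : l.length using Nat.strong_induction_on generalizing l with
  | _ n IH =>
    have ih : ∀ m : List Letter, m.length < l.length → (wordMat x m).trace ∈ R := by
      intro m hm
      exact IH m.length (hn ▸ hm) m rfl
    clear IH hn
    by_cases hl : l.length < 4
    · exact small_words x R h1 h2 l hl
    match l, hl, ih with
    | [], hl, _ => simp at hl
    | [a], hl, _ => simp at hl
    | [a, b], hl, _ => simp at hl
    | [a, b, c], hl, _ => simp at hl
    | [a, b, c, d], _, ih =>
      rcases red_any x R h1 h2 [] [d] a b c ih with h | ⟨rfl, h⟩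
      · exact h
      rcases red_any x R h1 h2 [a] [] b _ d ih with h' | ⟨rfl, -⟩
      · exact h'
      exact comm_words x R h1 h2 h4 a b h
    | [a, b, c, d, e], _, ih =>
      rcases red_any x R h1 h2 [] [d, e] a b c ih with h | ⟨rfl, h⟩
      · exact h
      rcases red_any x R h1 h2 [a] [e] b _ d ih with h' | ⟨rfl, -⟩
      · exact h'
      rcases red_any x R h1 h2 [a, b] [] _ _ e ih with h' | ⟨rfl, -⟩
      · exact h'
      have := red_pair x R h1 [] [b, a.inv, b.inv] a.inv.inv a rfl ih
      exact (word_rot x [a, b, a.inv, b.inv] [a.inv.inv]) ▸ this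
    | [a, b, c, d, e, f], _, ih =>
      rcases red_any x R h1 h2 [] [d, e, f] a b c ih with h | ⟨rfl, h⟩
      · exact h
      rcases red_any x R h1 h2 [a] [e, f] b _ d ih with h' | ⟨rfl, -⟩
      · exact h'
      rcases red_any x R h1 h2 [a, b] [f] _ _ e ih with h' | ⟨rfl, -⟩
      · exact h'
      rcases red_any x R h1 h2 [a, b, a.inv] [] _ _ f ih with h' | ⟨rfl, -⟩
      · exact h'
      rw [letter_inv_inv, letter_inv_inv] at *
      have := red_triple x R h1 h2 [] [a.inv, b.inv, a] b a h ih
      exact (word_rot x [a, b, a.inv, b.inv, a] [b]) ▸ this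
    | [a, b, c, d, e, f, g], _, ih =>
      rcases red_any x R h1 h2 [] [d, e, f, g] a b c ih with h | ⟨rfl, h⟩
      · exact h
      rcases red_any x R h1 h2 [a] [e, f, g] b _ d ih with h' | ⟨rfl, -⟩
      · exact h'
      rcases red_any x R h1 h2 [a, b] [f, g] _ _ e ih with h' | ⟨rfl, -⟩
      · exact h'
      rcases red_any x R h1 h2 [a, b, a.inv] [g] _ _ f ih with h' | ⟨rfl, -⟩
      · exact h'
      rcases red_any x R h1 h2 [a, b, a.inv, b.inv] [] _ _ g ih with h' | ⟨rfl, -⟩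
      · exact h'
      have := red_pair x R h1 [] [b, a.inv, b.inv, a.inv.inv, b.inv.inv] a.inv.inv.inv a rfl ih
      exact (word_rot x [a, b, a.inv, b.inv, a.inv.inv, b.inv.inv] [a.inv.inv.inv]) ▸ this
    | a :: b :: c :: d :: e :: f :: g :: k :: w, _, ih =>
      rcases red_any x R h1 h2 [] (d :: e :: f :: g :: k :: w) a b c ih with h | ⟨rfl, h⟩
      · exact h
      rcases red_any x R h1 h2 [a] (e :: f :: g :: k :: w) b _ d ih with h' | ⟨rfl, -⟩
      · exact h'
      rcases red_any x R h1 h2 [a, b] (f :: g :: k :: w) _ _ e ih with h' | ⟨rfl, -⟩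
      · exact h'
      rcases red_any x R h1 h2 [a, b, a.inv] (g :: k :: w) _ _ f ih with h' | ⟨rfl, -⟩
      · exact h'
      rcases red_any x R h1 h2 [a, b, a.inv, b.inv] (k :: w) _ _ g ih with h' | ⟨rfl, -⟩
      · exact h'
      rcases red_any x R h1 h2 [a, b, a.inv, b.inv, a.inv.inv] w _ _ k ih with h' | ⟨rfl, -⟩
      · exact h'
      rw [letter_inv_inv, letter_inv_inv] at *
      have hc := comm_words x R h1 h2 h4 a b h
      have hc' := comm_words x R h1 h2 h4 b a (Ne.symm h)
      have e : (wordMat x ([a, b, a.inv, b.inv] ++ ([a, b, a.inv, b.inv] ++ w))).trace =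
          (wordMat x [a, b, a.inv, b.inv]).trace * (wordMat x ([a, b, a.inv, b.inv] ++ w)).trace
          - (wordMat x [b, a, b.inv, a.inv]).trace * (wordMat x w).trace
          + (wordMat x ([b, a, b.inv, a.inv] ++ w)).trace := by
        rw [wordMat_append, wordMat_append, ← mul_assoc, ch_quad, word_four_adj,
          wordMat_append x [b, a, b.inv, a.inv]]
        simp only [add_mul, sub_mul, Matrix.trace_add, Matrix.trace_sub,
          Matrix.smul_mul, Matrix.trace_smul, smul_eq_mul, one_mul]
      refine (?_ : (wordMat x ([a, b, a.inv, b.inv] ++ ([a, b, a.inv, b.inv] ++ w))).trace ∈ R)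
      rw [e]
      refine add_mem (sub_mem (mul_mem hc (ih _ ?_)) (mul_mem hc' (ih _ ?_))) (ih _ ?_) <;>
      (simp only [List.length_append, List.length_cons, List.length_nil]; omega)

end TracePart

section PermPart
open Matrix

/-- Functions on `Option α` as pairs. -/
def optFunEquiv (α : Type) : (Fin 3 × (α → Fin 3)) ≃ (Option α → Fin 3) where
  toFun q := fun k => k.elim q.1 q.2
  invFun i := (i none, fun k => i (some k))
  left_inv := by intro q; rfl
  right_inv := by intro i; funext k; cases k <;> rfl

theorem perm_sum_mem {F : Type*} [CommRing F] [Algebra ℂ F] (R : Subalgebra ℂ F)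
    (M : Submonoid (Matrix (Fin 3) (Fin 3) F)) (hM : ∀ m ∈ M, Matrix.trace m ∈ R)
    (ι : Type) [Finite ι] : ∀ [Fintype ι] [DecidableEq ι] (σ : Equiv.Perm ι)
      (Y : ι → Matrix (Fin 3) (Fin 3) F), (∀ k, Y k ∈ M) →
      ∑ i : ι → Fin 3, ∏ k, Y k (i k) (i (σ k)) ∈ R := by
  induction ι using Finite.induction_empty_option with
  | @of_equiv α β e ih =>
    intro _ _ σ Y hY
    classical
    have : Fintype α := Fintype.ofEquiv β e.symm
    have := ih ((e.trans σ).trans e.symm) (fun k => Y (e k)) (fun k => hY _)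
    convert this using 1
    refine (Fintype.sum_equiv (Equiv.arrowCongr e (Equiv.refl _)) _ _ ?_).symm
    intro i
    refine Fintype.prod_equiv e _ _ ?_
    intro k
    simp [Equiv.arrowCongr]
  | h_empty =>
    intro _ _ σ Y hY
    simp
  | @h_option α _ ih =>
    intro _ _ σ Y hY
    classical
    rename_i _ iF iD
    obtain rfl : iF = instFintypeOption := Subsingleton.elim _ _
    rw [← (optFunEquiv α).sum_comp, Fintype.sum_prod_type_right]
    rcases h : σ none with _ | b
    · have hs : ∀ k, σ (some k) = some (Equiv.removeNone σ k) := by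
        intro k
        rw [Equiv.removeNone_some]
        by_contra hc
        have : σ (some k) = none := by
          rcases h' : σ (some k) with _ | c
          · rfl
          · exact absurd ⟨c, h'⟩ hc
        have := σ.injective (this.trans h.symm)
        simp at this
      have e : ∀ (i : α → Fin 3) (p : Fin 3), ∏ k, Y k (optFunEquiv α (p, i) k)
          (optFunEquiv α (p, i) (σ k)) =
          Y none p p * ∏ k, Y (some k) (i k) (i (Equiv.removeNone σ k)) := by
        intro i p
        rw [Fintype.prod_option]
        simp only [h, hs]
        rfl
      simp only [e]
      simp only [← Finset.sum_mul]
      rw [← Finset.mul_sum]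
      exact mul_mem (hM _ (hY none)) (ih (Equiv.removeNone σ) (fun k => Y (some k)) (fun k => hY _))
    · obtain ⟨a, ha⟩ : ∃ a, σ (some a) = none := by
        obtain ⟨a, ha⟩ := σ.surjective none
        rcases a with _ | a
        · rw [h] at ha; simp at ha
        · exact ⟨a, ha⟩
      have hta : Equiv.removeNone σ a = b := by
        have := Equiv.removeNone_none σ ha
        rw [h] at this
        exact Option.some_injective _ this
      have hs : ∀ k, k ≠ a → σ (some k) = some (Equiv.removeNone σ k) := by
        intro k hk
        rw [Equiv.removeNone_some]
        by_contra hc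
        have : σ (some k) = none := by
          rcases h' : σ (some k) with _ | c
          · rfl
          · exact absurd ⟨c, h'⟩ hc
        have := σ.injective (this.trans ha.symm)
        simp at this
        exact hk this
      have e : ∀ (i : α → Fin 3) (p : Fin 3), ∏ k, Y k (optFunEquiv α (p, i) k)
          (optFunEquiv α (p, i) (σ k)) =
          (Y (some a) (i a) p * Y none p (i b)) * ∏ k ∈ Finset.univ.erase a, Y (some k) (i k) (i (Equiv.removeNone σ k)) := by
        intro i p
        rw [Fintype.prod_option, ← Finset.mul_prod_erase Finset.univ _ (Finset.mem_univ a), ha, h,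
          ← mul_assoc, mul_comm (Y none _ _)]
        congr 1
        refine Finset.prod_congr rfl ?_
        intro k hk
        rw [hs k (Finset.ne_of_mem_erase hk)]
        rfl
      simp only [e]
      simp only [← Finset.sum_mul]
      have := ih (Equiv.removeNone σ) (fun k => if k = a then Y (some a) * Y none else Y (some k))
        (fun k => by
          split_ifs
          · exact mul_mem (hY _) (hY _)
          · exact hY _)
      convert this using 1
      refine Finset.sum_congr rfl ?_
      intro i _
      rw [← Finset.mul_prod_erase Finset.univ _ (Finset.mem_univ a), hta, if_pos rfl, Matrix.mul_apply]
      congr 1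
      refine Finset.prod_congr rfl ?_
      intro k hk
      rw [if_neg (Finset.ne_of_mem_erase hk)]

end PermPart


section PolarPart
open Matrix

theorem exists_equiv_of_fiber_card {α β γ : Type*} [Fintype α] [Fintype β] [DecidableEq γ]
    (u : α → γ) (v : β → γ)
    (h : ∀ c, Fintype.card {a // u a = c} = Fintype.card {b // v b = c}) :
    ∃ e : α ≃ β, ∀ a, v (e a) = u a :=
  ⟨Equiv.ofFiberEquiv fun c => Fintype.equivOfCardEq (h c), fun a => Equiv.ofFiberEquiv_map _ a⟩

theorem sum_single_apply {ι γ : Type*} [Fintype ι] [DecidableEq γ] (u : ι → γ) (e : γ) :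
    (∑ k, Finsupp.single (u k) 1 : γ →₀ ℕ) e = Fintype.card {k // u k = e} := by
  classical
  rw [Finsupp.finsetSum_apply, Fintype.card_subtype, Finset.card_filter]
  refine Finset.sum_congr rfl fun k _ => ?_
  rw [Finsupp.single_apply]

variable {ι κ : Type} [Fintype ι] [DecidableEq ι] [Fintype κ] [DecidableEq κ]

theorem scale_sl (X : Matrix (Fin 3) (Fin 3) ℂ) (hX : X.det ≠ 0) :
    ∃ (t : ℂ) (Y : SL3), t ≠ 0 ∧ X = t • (Y : Matrix (Fin 3) (Fin 3) ℂ) := by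
  obtain ⟨t, ht⟩ := IsAlgClosed.exists_pow_nat_eq X.det (n := 3) (by norm_num)
  have ht0 : t ≠ 0 := by
    rintro rfl
    apply hX; rw [← ht]; norm_num
  refine ⟨t, ⟨t⁻¹ • X, ?_⟩, ht0, ?_⟩
  · rw [Matrix.det_smul, Fintype.card_fin, ← ht, inv_pow, inv_mul_cancel₀ (pow_ne_zero _ ht0)]
  · simp [smul_smul, ht0]

theorem polar_zero (c : ι → κ) (S : (ι → Fin 3) → (ι → Fin 3) → ℂ)
    (hsym : ∀ h : Equiv.Perm ι, (∀ k, c (h k) = c k) → ∀ i j, S (i ∘ h) (j ∘ h) = S i j)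
    (hvan : ∀ X : κ → SL3, ∑ i, ∑ j, S i j * ∏ k, (X (c k) : Matrix (Fin 3) (Fin 3) ℂ) (i k) (j k) = 0) :
    ∀ i j, S i j = 0 := by
  let u : (ι → Fin 3) → (ι → Fin 3) → ι → κ × Fin 3 × Fin 3 := fun i j k => (c k, i k, j k)
  let Q : MvPolynomial (κ × Fin 3 × Fin 3) ℂ :=
    ∑ i, ∑ j, MvPolynomial.monomial (∑ k, Finsupp.single (u i j k) 1) (S i j)
  let ev : (κ → Matrix (Fin 3) (Fin 3) ℂ) → (κ × Fin 3 × Fin 3) → ℂ := fun X p => X p.1 p.2.1 p.2.2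
  have hQev : ∀ y : κ × Fin 3 × Fin 3 → ℂ, MvPolynomial.eval y Q =
      ∑ i, ∑ j, S i j * ∏ k, y (c k, i k, j k) := by
    intro y
    simp only [Q, map_sum]
    refine Finset.sum_congr rfl fun i _ => Finset.sum_congr rfl fun j _ => ?_
    have : MvPolynomial.monomial (∑ k, Finsupp.single (u i j k) 1) (S i j) =
      MvPolynomial.C (S i j) * ∏ k, MvPolynomial.X (u i j k) := by
      rw [MvPolynomial.monomial_sum_index]
      rfl
    rw [this]
    simp [u]
  have hvan2 : ∀ X : κ → Matrix (Fin 3) (Fin 3) ℂ, (∀ a, (X a).det ≠ 0) →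
      MvPolynomial.eval (ev X) Q = 0 := by
    intro X hX
    choose t Y ht hY using fun a => scale_sl (X a) (hX a)
    rw [hQev]
    have := hvan Y
    have e : ∀ i j : ι → Fin 3, S i j * ∏ k, ev X (c k, i k, j k) =
        (∏ k, t (c k)) * (S i j * ∏ k, (Y (c k) : Matrix (Fin 3) (Fin 3) ℂ) (i k) (j k)) := by
      intro i j
      have : ∀ k, ev X (c k, i k, j k) = t (c k) * (Y (c k) : Matrix (Fin 3) (Fin 3) ℂ) (i k) (j k) := by
        intro k
        simp only [ev]
        rw [hY (c k)]; rfl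
      simp only [this, Finset.prod_mul_distrib]
      ring
    simp only [e, ← Finset.mul_sum, this, mul_zero]
  let D : MvPolynomial (κ × Fin 3 × Fin 3) ℂ :=
    ∏ a, Matrix.det (Matrix.of fun p q => MvPolynomial.X (a, p, q))
  have hDev : ∀ y : κ × Fin 3 × Fin 3 → ℂ, MvPolynomial.eval y D =
      ∏ a, Matrix.det (Matrix.of fun p q => y (a, p, q)) := by
    intro y
    simp only [D, map_prod, RingHom.map_det]
    refine Finset.prod_congr rfl fun a _ => ?_
    congr 1
    ext p q
    simp
  have hD0 : D ≠ 0 := by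
    intro h
    have := hDev (ev fun _ => 1)
    rw [h] at this
    have e : (Matrix.of fun p q => (1 : Matrix (Fin 3) (Fin 3) ℂ) p q) = 1 := rfl
    simp [ev, e] at this
  have hQ0 : Q = 0 := by
    have : Q * D = 0 := by
      apply MvPolynomial.funext
      intro y
      rw [map_mul, map_zero]
      by_cases h : ∀ a, (Matrix.of fun p q => y (a, p, q)).det ≠ 0
      · rw [show y = ev (fun a => Matrix.of fun p q => y (a, p, q)) from rfl, hvan2 _ h, zero_mul]
      · push Not at h
        obtain ⟨a, ha⟩ := h
        rw [hDev, Finset.prod_eq_zero (Finset.mem_univ a) ha, mul_zero]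
    rcases mul_eq_zero.mp this with h | h
    · exact h
    · exact absurd h hD0
  intro i0 j0
  have hc : MvPolynomial.coeff (∑ k, Finsupp.single (u i0 j0 k) 1) Q = 0 := by rw [hQ0]; simp
  have hS : ∀ i j, (∑ k, Finsupp.single (u i j k) 1 : _ →₀ ℕ) = ∑ k, Finsupp.single (u i0 j0 k) 1 →
      S i j = S i0 j0 := by
    intro i j h
    obtain ⟨e, he⟩ := exists_equiv_of_fiber_card (u i0 j0) (u i j) (fun b => by
      rw [← sum_single_apply, ← sum_single_apply, h])
    simp only [u, Prod.mk.injEq] at he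
    rw [← hsym e (fun k => (he k).1) i j]
    congr 1
    · funext k; exact (he k).2.1
    · funext k; exact (he k).2.2
  simp only [Q, MvPolynomial.coeff_sum, MvPolynomial.coeff_monomial] at hc
  rw [← Finset.sum_product', ← Finset.sum_filter] at hc
  rw [Finset.sum_congr rfl (g := fun _ => S i0 j0)] at hc
  · rw [Finset.sum_const, nsmul_eq_mul, mul_eq_zero] at hc
    rcases hc with hc | hc
    · rw [Nat.cast_eq_zero, Finset.card_eq_zero] at hc
      have : (i0, j0) ∈ (∅ : Finset ((ι → Fin 3) × (ι → Fin 3))) := by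
        rw [← hc]; simp
      simp at this
    · exact hc
  · rintro ⟨i, j⟩ hij
    exact hS i j (Finset.mem_filter.mp hij).2

end PolarPart

section DoubleComm
open Matrix

variable {ι : Type} [Fintype ι] [DecidableEq ι]

/-- Action of permutations on the tensor power (functions of multi-indices). -/
noncomputable def tensRep (ι : Type) : Representation ℂ (Equiv.Perm ι) ((ι → Fin 3) → ℂ) where
  toFun g := { toFun := fun v i => v (i ∘ g)
               map_add' := fun _ _ => rfl
               map_smul' := fun _ _ => rfl }
  map_one' := rfl
  map_mul' := fun _ _ => rfl

theorem tensRep_apply (g : Equiv.Perm ι) (v : (ι → Fin 3) → ℂ) (i : ι → Fin 3) :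
    tensRep ι g v i = v (i ∘ g) := rfl

theorem double_comm (S : Matrix (ι → Fin 3) (ι → Fin 3) ℂ)
    (hS : ∀ T : Matrix (ι → Fin 3) (ι → Fin 3) ℂ,
      (∀ (h : Equiv.Perm ι) i j, T (i ∘ h) (j ∘ h) = T i j) → S * T = T * S) :
    ∃ a : Equiv.Perm ι → ℂ, ∀ i j, S i j = ∑ h, a h * (if i ∘ h = j then 1 else 0) := by
  classical
  let ρ := tensRep ι
  have key : ∀ (φ : Module.End (MonoidAlgebra ℂ (Equiv.Perm ι)) ρ.asModule) (v : ρ.asModule),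
      ρ.asModuleEquiv.symm (S *ᵥ ρ.asModuleEquiv (φ v)) =
      φ (ρ.asModuleEquiv.symm (S *ᵥ (ρ.asModuleEquiv v))) := by
    intro φ v
    let ψ : ((ι → Fin 3) → ℂ) →ₗ[ℂ] ((ι → Fin 3) → ℂ) :=
      ρ.asModuleEquiv.toLinearMap ∘ₗ (φ.restrictScalars ℂ) ∘ₗ ρ.asModuleEquiv.symm.toLinearMap
    have hψ : ∀ (g : Equiv.Perm ι) w, ψ (ρ g w) = ρ g (ψ w) := by
      intro g w
      simp only [ψ, LinearMap.comp_apply, LinearEquiv.coe_coe, LinearMap.restrictScalars_apply]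
      rw [Representation.asModuleEquiv_symm_map_rho, map_smul, Representation.asModuleEquiv_map_smul]
      simp
    let T := LinearMap.toMatrix' ψ
    have hT : ∀ w, T *ᵥ w = ψ w := fun w => by simp [T]
    have hinv : ∀ (h : Equiv.Perm ι) i j, T (i ∘ h) (j ∘ h) = T i j := by
      intro h i j
      have h1 : T i j = ψ (Pi.single j 1) i := by simp [T, LinearMap.toMatrix'_apply]
      have h2 : T (i ∘ h) (j ∘ h) = ψ (Pi.single (j ∘ h) 1) (i ∘ h) := by
        simp [T, LinearMap.toMatrix'_apply]
      rw [h1, h2]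
      have h3 : (Pi.single j 1 : (ι → Fin 3) → ℂ) = ρ h (Pi.single (j ∘ h) 1) := by
        funext i'
        rw [tensRep_apply]
        by_cases hij : i' = j
        · subst hij; simp
        · have : i' ∘ h ≠ j ∘ h := fun hc => hij (h.surjective.injective_comp_right hc)
          simp [hij, this]
      rw [h3, hψ, tensRep_apply]
    have hc := hS T hinv
    have e := congrArg (fun A => A *ᵥ (ρ.asModuleEquiv v)) hc
    simp only [← Matrix.mulVec_mulVec, hT] at e
    have e2 : ψ (ρ.asModuleEquiv v) = ρ.asModuleEquiv (φ v) := by simp [ψ]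
    have e3 : φ (ρ.asModuleEquiv.symm (S *ᵥ (ρ.asModuleEquiv v))) =
      ρ.asModuleEquiv.symm (ψ (S *ᵥ (ρ.asModuleEquiv v))) := by simp [ψ]
    rw [e3, ← e, e2]
  let f : Module.End (Module.End (MonoidAlgebra ℂ (Equiv.Perm ι)) ρ.asModule) ρ.asModule :=
    { toFun := fun v => ρ.asModuleEquiv.symm (S *ᵥ (ρ.asModuleEquiv v))
      map_add' := fun v w => by simp [Matrix.mulVec_add]
      map_smul' := fun φ v => key φ v }
  have : NeZero (Nat.card (Equiv.Perm ι) : ℂ) := ⟨by simp [Nat.card_eq_fintype_card, Fintype.card_ne_zero]⟩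
  obtain ⟨r, hr⟩ := jacobson_density f
    (Finset.univ.image (fun j : ι → Fin 3 => ρ.asModuleEquiv.symm (Pi.single j 1)))
  refine ⟨fun h => r.coeff h, fun i j => ?_⟩
  have h1 := hr (ρ.asModuleEquiv.symm (Pi.single j 1)) (Finset.mem_image_of_mem _ (Finset.mem_univ j))
  have h2 := congrArg (fun v => ρ.asModuleEquiv v i) h1
  simp only [Representation.asModuleEquiv_map_smul] at h2
  simp only [f, LinearMap.coe_mk, AddHom.coe_mk, LinearEquiv.apply_symm_apply] at h2
  rw [Matrix.mulVec_single_one, Representation.asAlgebraHom_def, MonoidAlgebra.lift_apply,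
    Finsupp.sum_fintype _ _ (by simp)] at h2
  simp only [Matrix.col_apply, LinearMap.sum_apply, Finset.sum_apply, LinearMap.smul_apply, Pi.smul_apply,
    smul_eq_mul] at h2
  rw [h2]
  refine Finset.sum_congr rfl fun h _ => ?_
  rw [tensRep_apply, Pi.single_apply]

end DoubleComm

section FFTPart
open Matrix

variable {ι κ : Type} [Fintype ι] [DecidableEq ι] [Fintype κ] [DecidableEq κ]

/-- Tensor product of a family of matrices. -/
def tens (M : ι → Matrix (Fin 3) (Fin 3) ℂ) : Matrix (ι → Fin 3) (ι → Fin 3) ℂ :=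
  Matrix.of fun i j => ∏ k, M k (i k) (j k)

theorem tens_apply (M : ι → Matrix (Fin 3) (Fin 3) ℂ) (i j : ι → Fin 3) :
    tens M i j = ∏ k, M k (i k) (j k) := rfl

theorem tens_mul (A B : ι → Matrix (Fin 3) (Fin 3) ℂ) :
    tens (fun k => A k * B k) = tens A * tens B := by
  ext i j
  simp only [tens_apply, Matrix.mul_apply]
  rw [Finset.prod_univ_sum, Fintype.piFinset_univ]
  simp only [Finset.prod_mul_distrib]

theorem tens_one : tens (fun _ : ι => (1 : Matrix (Fin 3) (Fin 3) ℂ)) = 1 := by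
  ext i j
  rw [tens_apply]
  by_cases h : i = j
  · subst h; simp
  · obtain ⟨k, hk⟩ := Function.ne_iff.mp h
    rw [Matrix.one_apply_ne h]
    exact Finset.prod_eq_zero (Finset.mem_univ k) (Matrix.one_apply_ne hk)

theorem tens_comp (M : ι → Matrix (Fin 3) (Fin 3) ℂ) (h : Equiv.Perm ι) (i j : ι → Fin 3) :
    tens (fun k => M (h k)) (i ∘ h) (j ∘ h) = tens M i j := by
  simp only [tens_apply, Function.comp]
  exact Equiv.prod_comp h (fun k => M k (i k) (j k))

theorem sum_comp_perm (h : Equiv.Perm ι) (f : (ι → Fin 3) → ℂ) :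
    ∑ i : ι → Fin 3, f (i ∘ h) = ∑ i, f i :=
  Equiv.sum_comp (Equiv.arrowCongr h.symm (Equiv.refl (Fin 3))) f

theorem sum_comp_perm2 (h : Equiv.Perm ι) (f : (ι → Fin 3) → (ι → Fin 3) → ℂ) :
    ∑ i : ι → Fin 3, ∑ j : ι → Fin 3, f (i ∘ h) (j ∘ h) = ∑ i, ∑ j, f i j := by
  rw [← sum_comp_perm h (fun i => ∑ j, f i j)]
  refine Finset.sum_congr rfl fun i _ => ?_
  exact sum_comp_perm h (fun j => f (i ∘ h) j)

/-- Invariance of a tensor under a permutation of the factors. -/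
def SymUnder (h : Equiv.Perm ι) (T : Matrix (ι → Fin 3) (ι → Fin 3) ℂ) : Prop :=
  ∀ i j, T (i ∘ h) (j ∘ h) = T i j

theorem SymUnder.mul {h : Equiv.Perm ι} {S T : Matrix (ι → Fin 3) (ι → Fin 3) ℂ}
    (hS : SymUnder h S) (hT : SymUnder h T) : SymUnder h (S * T) := by
  intro i j
  rw [Matrix.mul_apply, Matrix.mul_apply, ← sum_comp_perm h]
  refine Finset.sum_congr rfl fun l _ => ?_
  rw [hS, hT]

theorem symUnder_tens (c : ι → κ) (h : Equiv.Perm ι) (hc : ∀ k, c (h k) = c k)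
    (X : κ → Matrix (Fin 3) (Fin 3) ℂ) : SymUnder h (tens fun k => X (c k)) := by
  intro i j
  have := tens_comp (fun k => X (c k)) h i j
  simpa only [hc] using this

/-- Perms preserving a coloring. -/
def colorPerms (c : ι → κ) : Finset (Equiv.Perm ι) :=
  Finset.univ.filter fun h => ∀ k, c (h k) = c k

theorem mem_colorPerms (c : ι → κ) (h : Equiv.Perm ι) :
    h ∈ colorPerms c ↔ ∀ k, c (h k) = c k := by simp [colorPerms]

/-- Symmetrization. -/
def symz (c : ι → κ) (S : Matrix (ι → Fin 3) (ι → Fin 3) ℂ) :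
    Matrix (ι → Fin 3) (ι → Fin 3) ℂ :=
  Matrix.of fun i j => ∑ h ∈ colorPerms c, S (i ∘ h) (j ∘ h)

theorem symz_apply (c : ι → κ) (S : Matrix (ι → Fin 3) (ι → Fin 3) ℂ) (i j) :
    symz c S i j = ∑ h ∈ colorPerms c, S (i ∘ h) (j ∘ h) := rfl

theorem symz_sym (c : ι → κ) (S : Matrix (ι → Fin 3) (ι → Fin 3) ℂ) (g : Equiv.Perm ι)
    (hg : ∀ k, c (g k) = c k) : SymUnder g (symz c S) := by
  intro i j
  rw [symz_apply, symz_apply]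
  refine Finset.sum_bij' (fun h _ => g * h) (fun h _ => g⁻¹ * h) ?_ ?_ ?_ ?_ ?_
  · intro h hh
    rw [mem_colorPerms] at hh ⊢
    intro k; rw [Equiv.Perm.mul_apply, hg, hh]
  · intro h hh
    rw [mem_colorPerms] at hh ⊢
    intro k
    rw [← hg ((g⁻¹ * h) k), ← hh k]
    exact congrArg c (Equiv.apply_symm_apply g (h k))
  · intro h _; simp
  · intro h _; simp
  · intro h _; rfl

theorem symz_pair (c : ι → κ) (S T : Matrix (ι → Fin 3) (ι → Fin 3) ℂ)
    (hT : ∀ h, (∀ k, c (h k) = c k) → SymUnder h T) :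
    ∑ i, ∑ j, symz c S i j * T i j = ((colorPerms c).card : ℂ) * ∑ i, ∑ j, S i j * T i j := by
  have e : ∀ h ∈ colorPerms c, ∑ i, ∑ j, S (i ∘ h) (j ∘ h) * T i j = ∑ i, ∑ j, S i j * T i j := by
    intro h hh
    rw [mem_colorPerms] at hh
    rw [← sum_comp_perm2 h (fun i j => S i j * T i j)]
    simp only [hT h hh _ _]
  rw [← nsmul_eq_mul, ← Finset.sum_const, ← Finset.sum_congr rfl e]
  have e2 : ∀ i, ∑ j, symz c S i j * T i j =
      ∑ h ∈ colorPerms c, ∑ j, S (i ∘ h) (j ∘ h) * T i j := by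
    intro i
    rw [Finset.sum_comm]
    refine Finset.sum_congr rfl fun j _ => ?_
    rw [symz_apply, Finset.sum_mul]
  exact (Finset.sum_congr rfl fun i _ => e2 i).trans Finset.sum_comm

theorem colorPerms_card_ne (c : ι → κ) : ((colorPerms c).card : ℂ) ≠ 0 := by
  rw [Nat.cast_ne_zero, Finset.card_ne_zero]
  exact ⟨1, by simp [mem_colorPerms]⟩

/-- A tensor commuting with all `g ⊗ ... ⊗ g` commutes with all symmetric tensors. -/
theorem comm_sym (S : Matrix (ι → Fin 3) (ι → Fin 3) ℂ)
    (hS : ∀ g : SL3, S * tens (fun _ => (g : Matrix (Fin 3) (Fin 3) ℂ)) =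
      tens (fun _ => (g : Matrix (Fin 3) (Fin 3) ℂ)) * S)
    (T : Matrix (ι → Fin 3) (ι → Fin 3) ℂ) (hT : ∀ h, SymUnder h T) : S * T = T * S := by
  ext p q
  let L : Matrix (ι → Fin 3) (ι → Fin 3) ℂ := Matrix.of fun i j =>
    S p i * (if j = q then 1 else 0) - (if i = p then 1 else 0) * S j q
  have hL : ∀ T : Matrix (ι → Fin 3) (ι → Fin 3) ℂ,
      ∑ i, ∑ j, L i j * T i j = (S * T) p q - (T * S) p q := by
    intro T
    simp only [L, Matrix.of_apply, sub_mul, Finset.sum_sub_distrib, Matrix.mul_apply]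
    congr 1
    · refine Finset.sum_congr rfl fun i _ => ?_
      simp
    · simp [mul_comm]
  let c : ι → Unit := fun _ => ()
  have hz : ∀ i j, symz c L i j = 0 := by
    refine polar_zero c (symz c L) (fun h hh => symz_sym c L h hh) ?_
    intro X
    have := symz_pair c L (tens fun k => (X (c k) : Matrix (Fin 3) (Fin 3) ℂ))
      (fun h hh => symUnder_tens c h hh (fun a => (X a : Matrix (Fin 3) (Fin 3) ℂ)))
    simp only [tens_apply] at this
    rw [this]
    have h2 := hL (tens fun k => (X (c k) : Matrix (Fin 3) (Fin 3) ℂ))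
    simp only [tens_apply] at h2
    rw [h2]
    have h3 := hS (X ())
    rw [show (tens fun k => (X (c k) : Matrix (Fin 3) (Fin 3) ℂ)) =
      tens (fun _ => (X () : Matrix (Fin 3) (Fin 3) ℂ)) from rfl, h3, sub_self, mul_zero]
  have h1 := symz_pair c L T (fun h _ => hT h)
  simp only [hz, zero_mul, Finset.sum_const_zero] at h1
  rw [hL] at h1
  rcases mul_eq_zero.mp h1.symm with h | h
  · exact absurd h (colorPerms_card_ne c)
  · exact sub_eq_zero.mp h

set_option maxHeartbeats 1000000 in
theorem homog_invariant (c : ι → κ) (S : (ι → Fin 3) → (ι → Fin 3) → ℂ)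
    (hinv : ∀ (g : SL3) (X : κ → SL3),
      ∑ i, ∑ j, S i j * ∏ k, ((g * X (c k) * g⁻¹ : SL3) : Matrix (Fin 3) (Fin 3) ℂ) (i k) (j k) =
      ∑ i, ∑ j, S i j * ∏ k, (X (c k) : Matrix (Fin 3) (Fin 3) ℂ) (i k) (j k)) :
    ∃ a : Equiv.Perm ι → ℂ, ∀ X : κ → SL3,
      ∑ i, ∑ j, S i j * ∏ k, (X (c k) : Matrix (Fin 3) (Fin 3) ℂ) (i k) (j k) =
      ∑ h, a h * ∑ i : ι → Fin 3, ∏ k, (X (c k) : Matrix (Fin 3) (Fin 3) ℂ) (i k) (i (h k)) := by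
  let S1 := symz c (Matrix.of S)
  let tX : (κ → SL3) → Matrix (ι → Fin 3) (ι → Fin 3) ℂ :=
    fun X => tens fun k => (X (c k) : Matrix (Fin 3) (Fin 3) ℂ)
  have hpair : ∀ X : κ → SL3, ∑ i, ∑ j, S1 i j * tX X i j =
      ((colorPerms c).card : ℂ) * ∑ i, ∑ j, S i j * tX X i j := by
    intro X
    exact symz_pair c (Matrix.of S) (tX X)
      (fun h hh => symUnder_tens c h hh (fun a => (X a : Matrix (Fin 3) (Fin 3) ℂ)))
  have htr : ∀ (A B : Matrix (ι → Fin 3) (ι → Fin 3) ℂ),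
      ∑ i, ∑ j, A i j * B i j = (Aᵀ * B).trace := by
    intro A B
    rw [Matrix.trace, Finset.sum_comm]
    rfl
  let tg : SL3 → Matrix (ι → Fin 3) (ι → Fin 3) ℂ :=
    fun g => tens fun _ => (g : Matrix (Fin 3) (Fin 3) ℂ)
  have htg : ∀ g, tg g * tg g⁻¹ = 1 := by
    intro g
    simp only [tg]
    rw [← tens_mul, ← tens_one]
    congr 1
    funext k
    rw [← Matrix.SpecialLinearGroup.coe_mul]; simp
  have hsymg : ∀ g h, SymUnder h (tg g) := by
    intro g h
    exact symUnder_tens (fun _ => ()) h (fun _ => rfl) (fun _ => (g : Matrix (Fin 3) (Fin 3) ℂ))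
  have hcomm : ∀ g : SL3, S1ᵀ * tg g = tg g * S1ᵀ := by
    intro g
    let S2 : Matrix (ι → Fin 3) (ι → Fin 3) ℂ := (tg g⁻¹ * S1ᵀ * tg g)ᵀ - S1
    have hS1t : ∀ h, (∀ k, c (h k) = c k) → SymUnder h S1ᵀ := fun h hh i j =>
      symz_sym c (Matrix.of S) h hh j i
    have h0 : ∀ i j, S2 i j = 0 := by
      refine polar_zero c S2 ?_ ?_
      · intro h hh i j
        have e1 := ((hsymg g⁻¹ h).mul (hS1t h hh)).mul (hsymg g h) j i
        have e2 := hS1t h hh j i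
        simp only [Matrix.transpose_apply] at e2
        simp only [S2, Matrix.sub_apply, Matrix.transpose_apply]
        rw [e1, e2]
      · intro X
        have e : ∑ i, ∑ j, S2 i j * tX X i j = 0 := by
          rw [htr]
          simp only [S2, Matrix.transpose_sub, Matrix.transpose_transpose, sub_mul, Matrix.trace_sub]
          have e1 : (tg g⁻¹ * S1ᵀ * tg g * tX X).trace = (S1ᵀ * tX (fun a => g * X a * g⁻¹)).trace := by
            have : tX (fun a => g * X a * g⁻¹) = tg g * tX X * tg g⁻¹ := by
              simp only [tX, tg]
              rw [← tens_mul, ← tens_mul]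
              simp only [Matrix.SpecialLinearGroup.coe_mul]
            rw [this, Matrix.mul_assoc, Matrix.mul_assoc, Matrix.trace_mul_comm]
            simp only [Matrix.mul_assoc]
          have q1 := (htr S1 (tX fun a => g * X a * g⁻¹)).symm.trans (hpair fun a => g * X a * g⁻¹)
          have q2 := (htr S1 (tX X)).symm.trans (hpair X)
          rw [e1, q1, q2, ← mul_sub]
          have := hinv g X
          simp only [tX, tens_apply]
          rw [this, sub_self, mul_zero]
        exact e
    have h1 : tg g⁻¹ * S1ᵀ * tg g = S1ᵀ := by
      ext i j
      have := h0 j i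
      simp only [S2, Matrix.sub_apply, Matrix.transpose_apply] at this
      exact sub_eq_zero.mp this
    calc S1ᵀ * tg g = (tg g * tg g⁻¹) * S1ᵀ * tg g := by rw [htg, one_mul]
      _ = tg g * (tg g⁻¹ * S1ᵀ * tg g) := by simp only [Matrix.mul_assoc]
      _ = tg g * S1ᵀ := by rw [h1]
  obtain ⟨a, ha⟩ := double_comm S1ᵀ (fun T hT => comm_sym S1ᵀ hcomm T hT)
  refine ⟨fun h => ((colorPerms c).card : ℂ)⁻¹ * a h⁻¹, fun X => ?_⟩
  have hp := hpair X
  have hcard := colorPerms_card_ne c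
  have e0 : ∑ i, ∑ j, S i j * ∏ k, (X (c k) : Matrix (Fin 3) (Fin 3) ℂ) (i k) (j k) =
     ((colorPerms c).card : ℂ)⁻¹ * ∑ i, ∑ j, S1 i j * tX X i j := by
    rw [hp, inv_mul_cancel_left₀ hcard]; rfl
  rw [e0]
  simp only [mul_assoc, ← Finset.mul_sum]
  congr 1
  rw [← Equiv.sum_comp (Equiv.inv (Equiv.Perm ι))]
  have e1 : ∀ i j, S1 i j = ∑ h, a h * (if j ∘ h = i then 1 else 0) := fun i j => ha j i
  simp only [e1, Finset.sum_mul]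
  rw [Finset.sum_comm]
  have e2 : ∀ j : ι → Fin 3, ∑ i : ι → Fin 3, ∑ h : Equiv.Perm ι, a h * (if j ∘ h = i then 1 else 0) * tX X i j
     = ∑ h : Equiv.Perm ι, a h * tX X (j ∘ h) j := by
    intro j
    rw [Finset.sum_comm]
    refine Finset.sum_congr rfl fun h _ => ?_
    simp
  simp only [e2]
  rw [Finset.sum_comm]
  refine Finset.sum_congr rfl fun h _ => ?_
  simp only [Equiv.inv_apply, inv_inv]
  rw [← Finset.mul_sum]
  congr 1
  rw [← sum_comp_perm h⁻¹]
  refine Finset.sum_congr rfl fun i _ => ?_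
  simp only [tX, tens_apply, Function.comp]
  simp

end FFTPart

section Homog
open Matrix

/-- Monomial function on a pair of matrices. -/
noncomputable def monoFun {β : Type} [Fintype β] (c : β → Fin 2) (i j : β → Fin 3) :
    (Fin 2 → SL3) → ℂ :=
  fun X => ∏ k, (X (c k) : Matrix (Fin 3) (Fin 3) ℂ) (i k) (j k)

/-- The monomial functions of bidegree `n`. -/
def monoSet (n : Fin 2 → ℕ) : Set ((Fin 2 → SL3) → ℂ) :=
  {f | ∃ (β : Type) (_ : Fintype β) (c : β → Fin 2) (i j : β → Fin 3),
    (∀ a, Fintype.card {b // c b = a} = n a) ∧ f = monoFun c i j}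

/-- Functions of bidegree `n`. -/
def homFun (n : Fin 2 → ℕ) : Submodule ℂ ((Fin 2 → SL3) → ℂ) := Submodule.span ℂ (monoSet n)

theorem monoSet_mul {n m : Fin 2 → ℕ} {f g : (Fin 2 → SL3) → ℂ} (hf : f ∈ monoSet n)
    (hg : g ∈ monoSet m) : f * g ∈ monoSet (n + m) := by
  obtain ⟨β, _, c, i, j, hc, rfl⟩ := hf
  obtain ⟨γ, _, d, p, q, hd, rfl⟩ := hg
  refine ⟨β ⊕ γ, inferInstance, Sum.elim c d, Sum.elim i p, Sum.elim j q, fun a => ?_, ?_⟩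
  · rw [Pi.add_apply, ← hc, ← hd, ← Fintype.card_sum]
    refine Fintype.card_congr (Equiv.subtypeSum.trans ?_)
    rfl
  · funext X
    simp [monoFun, Fintype.prod_sum_type]

theorem homFun_mul {n m : Fin 2 → ℕ} {f g : (Fin 2 → SL3) → ℂ} (hf : f ∈ homFun n)
    (hg : g ∈ homFun m) : f * g ∈ homFun (n + m) := by
  have h := Submodule.mul_mem_mul hf hg
  rw [homFun, homFun, Submodule.span_mul_span] at h
  refine Submodule.span_mono ?_ h
  rintro _ ⟨a, ha, b, hb, rfl⟩
  exact monoSet_mul ha hb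

theorem one_mem_homFun : (1 : (Fin 2 → SL3) → ℂ) ∈ homFun 0 := by
  refine Submodule.subset_span ⟨Empty, inferInstance, Empty.elim, Empty.elim, Empty.elim, ?_, ?_⟩
  · intro a; simp
  · funext X; simp [monoFun]

theorem coord_mem_homFun (a : Fin 2) (p q : Fin 3) :
    (fun X : Fin 2 → SL3 => (X a : Matrix (Fin 3) (Fin 3) ℂ) p q) ∈ homFun (Pi.single a 1) := by
  refine Submodule.subset_span ⟨Unit, inferInstance, fun _ => a, fun _ => p, fun _ => q, ?_, ?_⟩
  · intro b
    rcases eq_or_ne a b with rfl | h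
    · simp
    · simp [h, Pi.single_eq_of_ne' h]
  · funext X; simp [monoFun]

theorem one_mem_homFun_three (a : Fin 2) :
    (1 : (Fin 2 → SL3) → ℂ) ∈ homFun (Pi.single a 3) := by
  have key : ∀ p q r s t u : Fin 3, (fun X : Fin 2 → SL3 =>
      (X a : Matrix (Fin 3) (Fin 3) ℂ) p q * (X a : Matrix (Fin 3) (Fin 3) ℂ) r s *
      (X a : Matrix (Fin 3) (Fin 3) ℂ) t u) ∈ homFun (Pi.single a 3) := by
    intro p q r s t u
    have := homFun_mul (homFun_mul (coord_mem_homFun a p q) (coord_mem_homFun a r s))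
      (coord_mem_homFun a t u)
    rw [← Pi.single_add, ← Pi.single_add] at this
    exact this
  have hm := sub_mem (add_mem (add_mem (sub_mem (sub_mem (key 0 0 1 1 2 2) (key 0 0 1 2 2 1))
    (key 0 1 1 0 2 2)) (key 0 1 1 2 2 0)) (key 0 2 1 0 2 1)) (key 0 2 1 1 2 0)
  convert hm using 1
  funext X
  exact ((X a).det_coe.symm.trans (Matrix.det_fin_three _))

theorem one_mem_homFun_mul (a : Fin 2) (k : ℕ) :
    (1 : (Fin 2 → SL3) → ℂ) ∈ homFun (Pi.single a (3 * k)) := by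
  induction k with
  | zero => simpa using one_mem_homFun
  | succ k ih =>
    have := homFun_mul ih (one_mem_homFun_three a)
    rwa [← Pi.single_add, mul_one] at this

theorem homFun_le {n m : Fin 2 → ℕ} (h : ∀ a, n a ≤ m a)
    (h3 : ∀ a, (n a : ZMod 3) = m a) : homFun n ≤ homFun m := by
  intro f hf
  have hk : ∀ a, ∃ k, m a = n a + 3 * k := by
    intro a
    have := (ZMod.natCast_eq_natCast_iff' _ _ _).mp (h3 a)
    have := h a
    exact ⟨(m a - n a) / 3, by omega⟩
  choose k hk using hk
  have h1 := homFun_mul (homFun_mul hf (one_mem_homFun_mul 0 (k 0))) (one_mem_homFun_mul 1 (k 1))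
  rw [mul_one, mul_one] at h1
  convert h1 using 2
  funext a
  fin_cases a <;> simp [hk]

/-- Functions homogeneous modulo three. -/
def resFun (r : Fin 2 → ZMod 3) : Set ((Fin 2 → SL3) → ℂ) :=
  {f | ∃ n : Fin 2 → ℕ, (∀ a, (n a : ZMod 3) = r a) ∧ f ∈ homFun n}

theorem resFun_zero (r) : (0 : (Fin 2 → SL3) → ℂ) ∈ resFun r :=
  ⟨fun a => (r a).val, fun a => by simp, zero_mem _⟩

theorem resFun_add {r} {f g : (Fin 2 → SL3) → ℂ} (hf : f ∈ resFun r) (hg : g ∈ resFun r) :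
    f + g ∈ resFun r := by
  obtain ⟨n, hn, hf⟩ := hf
  obtain ⟨m, hm, hg⟩ := hg
  have hs : ∀ a, (((n ⊔ m) a : ℕ) : ZMod 3) = r a := by
    intro a
    rw [Pi.sup_apply]
    rcases le_total (n a) (m a) with h | h
    · rw [sup_eq_right.mpr h, hm]
    · rw [sup_eq_left.mpr h, hn]
  refine ⟨n ⊔ m, hs, add_mem (homFun_le ?_ ?_ hf) (homFun_le ?_ ?_ hg)⟩
  · intro a; exact le_sup_left (a := n) a
  · intro a; rw [hs, hn]
  · intro a; exact le_sup_right (a := n) a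
  · intro a; rw [hs, hm]

theorem exists_decomp (P : MvPolynomial (Fin 2 × Fin 3 × Fin 3) ℂ) :
    ∃ Q : (Fin 2 → ZMod 3) → (Fin 2 → SL3) → ℂ, (∀ r, Q r ∈ resFun r) ∧
      ∀ X : Fin 2 → SL3, MvPolynomial.eval
          (fun p => (X p.1 : Matrix (Fin 3) (Fin 3) ℂ) p.2.1 p.2.2) P = ∑ r, Q r X := by
  induction P using MvPolynomial.induction_on with
  | C z =>
    refine ⟨Pi.single 0 (z • 1), fun r => ?_, fun X => ?_⟩
    · rcases eq_or_ne r 0 with rfl | h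
      · rw [Pi.single_eq_same]
        exact ⟨0, fun a => by simp, Submodule.smul_mem _ _ one_mem_homFun⟩
      · rw [Pi.single_eq_of_ne h]; exact resFun_zero r
    · rw [MvPolynomial.eval_C, Finset.sum_eq_single 0]
      · simp
      · intro r _ h; rw [Pi.single_eq_of_ne h]; rfl
      · simp
  | add p q hp hq =>
    obtain ⟨Q1, h1, e1⟩ := hp
    obtain ⟨Q2, h2, e2⟩ := hq
    refine ⟨fun r => Q1 r + Q2 r, fun r => resFun_add (h1 r) (h2 r), fun X => ?_⟩
    rw [map_add, e1, e2, ← Finset.sum_add_distrib]; rfl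
  | mul_X p e hp =>
    obtain ⟨Q, h, e1⟩ := hp
    refine ⟨fun r => Q (r - Pi.single e.1 1) *
      (fun X : Fin 2 → SL3 => (X e.1 : Matrix (Fin 3) (Fin 3) ℂ) e.2.1 e.2.2), fun r => ?_,
      fun X => ?_⟩
    · obtain ⟨n, hn, hf⟩ := h (r - Pi.single e.1 1)
      refine ⟨n + Pi.single e.1 1, fun a => ?_, homFun_mul hf (coord_mem_homFun _ _ _)⟩
      rw [Pi.add_apply, Nat.cast_add, hn, Pi.sub_apply]
      rcases eq_or_ne a e.1 with rfl | h
      · simp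
      · simp [Pi.single_eq_of_ne h]
    · rw [map_mul, e1, MvPolynomial.eval_X, Finset.sum_mul,
        ← Equiv.sum_comp (Equiv.subRight (Pi.single e.1 1))]
      rfl

/-- Scaling by cube roots of unity. -/
noncomputable def scaleSL (t : Fin 2 → rootsOfUnity 3 ℂ) (X : Fin 2 → SL3) (a : Fin 2) : SL3 :=
  ⟨((t a : ℂˣ) : ℂ) • (X a : Matrix (Fin 3) (Fin 3) ℂ), by
    rw [Matrix.det_smul, (X a).det_coe, mul_one, Fintype.card_fin]
    have := (t a).2
    rw [mem_rootsOfUnity] at this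
    rw [← Units.val_pow_eq_pow_val, this, Units.val_one]⟩

theorem scaleSL_conj (t : Fin 2 → rootsOfUnity 3 ℂ) (X : Fin 2 → SL3) (g : SL3) (a : Fin 2) :
    g * scaleSL t X a * g⁻¹ = scaleSL t (fun b => g * X b * g⁻¹) a := by
  apply Subtype.ext
  rw [Matrix.SpecialLinearGroup.coe_mul, Matrix.SpecialLinearGroup.coe_mul]
  change (g : Matrix (Fin 3) (Fin 3) ℂ) * (((t a : ℂˣ) : ℂ) • (X a : Matrix (Fin 3) (Fin 3) ℂ)) *
      ((g⁻¹ : SL3) : Matrix (Fin 3) (Fin 3) ℂ) =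
    ((t a : ℂˣ) : ℂ) • ((g * X a * g⁻¹ : SL3) : Matrix (Fin 3) (Fin 3) ℂ)
  rw [Matrix.SpecialLinearGroup.coe_mul, Matrix.SpecialLinearGroup.coe_mul, Matrix.mul_smul,
    Matrix.smul_mul]

/-- Characters. -/
noncomputable def chr (r : Fin 2 → ZMod 3) : (Fin 2 → rootsOfUnity 3 ℂ) →* ℂ where
  toFun t := ∏ a, (((t a : ℂˣ) : ℂ)) ^ (r a).val
  map_one' := by simp
  map_mul' := by intro s t; simp [mul_pow, Finset.prod_mul_distrib]

theorem chr_injective : Function.Injective chr := by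
  intro r s h
  have hp : IsPrimitiveRoot (Complex.exp (2 * Real.pi * Complex.I / (3 : ℕ))) 3 :=
    Complex.isPrimitiveRoot_exp 3 (by norm_num)
  funext a
  have h1 := congrArg (fun f : (Fin 2 → rootsOfUnity 3 ℂ) →* ℂ =>
    f (Pi.mulSingle a hp.toRootsOfUnity)) h
  have e : ∀ r, chr r (Pi.mulSingle a hp.toRootsOfUnity) =
      (Complex.exp (2 * Real.pi * Complex.I / (3 : ℕ))) ^ (r a).val := by
    intro r
    simp only [chr, MonoidHom.coe_mk, OneHom.coe_mk]
    rw [Finset.prod_eq_single a]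
    · rw [Pi.mulSingle_eq_same]; rfl
    · intro b _ hb; rw [Pi.mulSingle_eq_of_ne hb]; simp
    · simp
  simp only [e] at h1
  exact ZMod.val_injective 3 (hp.pow_inj (ZMod.val_lt _) (ZMod.val_lt _) h1)

theorem resFun_scale {r} {f : (Fin 2 → SL3) → ℂ} (hf : f ∈ resFun r)
    (t : Fin 2 → rootsOfUnity 3 ℂ) (X : Fin 2 → SL3) : f (scaleSL t X) = chr r t * f X := by
  obtain ⟨n, hn, hf⟩ := hf
  have hc : chr r t = ∏ a, (((t a : ℂˣ) : ℂ)) ^ (n a) := by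
    simp only [chr, MonoidHom.coe_mk, OneHom.coe_mk]
    refine Finset.prod_congr rfl fun a _ => ?_
    have h3 : (((t a : ℂˣ) : ℂ)) ^ 3 = 1 := by
      have := (t a).2
      rw [mem_rootsOfUnity] at this
      rw [← Units.val_pow_eq_pow_val, this, Units.val_one]
    rw [← hn, ZMod.val_natCast, ← pow_eq_pow_mod _ h3]
  induction hf using Submodule.span_induction with
  | mem f hf =>
    obtain ⟨β, _, c, i, j, hcard, rfl⟩ := hf
    simp only [monoFun, scaleSL, Matrix.smul_apply, smul_eq_mul, Finset.prod_mul_distrib]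
    congr 1
    rw [hc, ← Finset.prod_fiberwise (s := Finset.univ) (g := c)]
    refine Finset.prod_congr rfl fun a _ => ?_
    rw [← hcard, Fintype.card_subtype, Finset.prod_congr rfl, Finset.prod_const]
    intro b hb
    rw [(Finset.mem_filter.mp hb).2]
  | zero => simp
  | add f g _ _ h1 h2 => simp only [Pi.add_apply, h1, h2, mul_add]
  | smul z f _ h1 => simp only [Pi.smul_apply, smul_eq_mul, h1]; ring

theorem component_inv (Q : (Fin 2 → ZMod 3) → (Fin 2 → SL3) → ℂ) (hQ : ∀ r, Q r ∈ resFun r)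
    (hinv : ∀ (g : SL3) (X : Fin 2 → SL3), ∑ r, Q r (fun a => g * X a * g⁻¹) = ∑ r, Q r X)
    (r) (g : SL3) (X : Fin 2 → SL3) : Q r (fun a => g * X a * g⁻¹) = Q r X := by
  have hli := (linearIndependent_monoidHom (Fin 2 → rootsOfUnity 3 ℂ) ℂ).comp chr chr_injective
  rw [Fintype.linearIndependent_iff] at hli
  refine sub_eq_zero.mp (hli (fun r => Q r (fun a => g * X a * g⁻¹) - Q r X) ?_ r)
  funext t
  have h := hinv g (scaleSL t X)
  simp only [scaleSL_conj] at h
  have h1 : ∀ r, Q r (scaleSL t fun b => g * X b * g⁻¹) = _ := fun r => resFun_scale (hQ r) _ _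
  have h2 : ∀ r, Q r (scaleSL t X) = _ := fun r => resFun_scale (hQ r) _ _
  have h' : ∑ r, Q r (scaleSL t fun b => g * X b * g⁻¹) = ∑ r, Q r (scaleSL t X) := h
  simp only [h1, h2] at h'
  rw [← sub_eq_zero, ← Finset.sum_sub_distrib] at h'
  simp only [Finset.sum_apply, Pi.smul_apply, smul_eq_mul, Function.comp, Pi.zero_apply]
  rw [← h']
  refine Finset.sum_congr rfl fun r _ => ?_
  ring

theorem homFun_tensor {n : Fin 2 → ℕ} {f : (Fin 2 → SL3) → ℂ} (hf : f ∈ homFun n) :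
    ∃ S : ((Σ a, Fin (n a)) → Fin 3) → ((Σ a, Fin (n a)) → Fin 3) → ℂ, ∀ X,
      f X = ∑ i, ∑ j, S i j * ∏ k, (X k.1 : Matrix (Fin 3) (Fin 3) ℂ) (i k) (j k) := by
  induction hf using Submodule.span_induction with
  | mem f hf =>
    obtain ⟨β, _, c, i, j, hcard, rfl⟩ := hf
    obtain ⟨e, he⟩ := exists_equiv_of_fiber_card
      (Sigma.fst : (Σ a, Fin (n a)) → Fin 2) c (by
        intro a
        rw [hcard, Fintype.card_congr (Equiv.sigmaSubtype a), Fintype.card_fin])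
    refine ⟨fun p q => if p = i ∘ e then (if q = j ∘ e then 1 else 0) else 0, fun X => ?_⟩
    rw [Finset.sum_eq_single (i ∘ e), Finset.sum_eq_single (j ∘ e)]
    · simp only [if_true, one_mul, monoFun, Function.comp]
      rw [← Equiv.prod_comp e]
      simp only [he]
    · intro q _ h; simp [h]
    · simp
    · intro q _ h; simp [h]
    · simp
  | zero => exact ⟨0, by simp⟩
  | add f g _ _ h1 h2 =>
    obtain ⟨S, hS⟩ := h1
    obtain ⟨T, hT⟩ := h2
    refine ⟨S + T, fun X => ?_⟩
    simp only [Pi.add_apply, add_mul, Finset.sum_add_distrib, hS, hT]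
  | smul z f _ h1 =>
    obtain ⟨S, hS⟩ := h1
    refine ⟨z • S, fun X => ?_⟩
    simp only [Pi.smul_apply, smul_eq_mul, mul_assoc, ← Finset.mul_sum, hS]

end Homog

section Assembly
open Matrix

/-- The two generic matrices over the ring of functions. -/
noncomputable def genMat (b : Bool) : Matrix.SpecialLinearGroup (Fin 3) (SL3 × SL3 → ℂ) :=
  ⟨Matrix.of fun i j => fun X =>
    ((if b then X.1 else X.2 : SL3) : Matrix (Fin 3) (Fin 3) ℂ) i j, by
    funext X
    have h := (if b then X.1 else X.2 : SL3).det_coe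
    rw [Matrix.det_fin_three] at h ⊢
    exact h⟩

/-- Evaluation of a matrix of functions at a point. -/
noncomputable def evM (X : SL3 × SL3) (A : Matrix (Fin 3) (Fin 3) (SL3 × SL3 → ℂ)) :
    Matrix (Fin 3) (Fin 3) ℂ := (Pi.evalRingHom (fun _ => ℂ) X).mapMatrix A

theorem evM_mul (X : SL3 × SL3) (A B : Matrix (Fin 3) (Fin 3) (SL3 × SL3 → ℂ)) :
    evM X (A * B) = evM X A * evM X B := map_mul _ A B

theorem evM_one (X : SL3 × SL3) : evM X 1 = 1 := map_one _

theorem trace_evM (X : SL3 × SL3) (A : Matrix (Fin 3) (Fin 3) (SL3 × SL3 → ℂ)) :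
    A.trace X = (evM X A).trace := by
  simp [Matrix.trace, evM, Fin.sum_univ_three]

theorem evM_letter (X : SL3 × SL3) (b s : Bool) : evM X (letterMat genMat (b, s)) =
    ((if s then (if b then X.1 else X.2) else (if b then X.1 else X.2)⁻¹ : SL3) :
      Matrix (Fin 3) (Fin 3) ℂ) := by
  have h0 : evM X (genMat b : Matrix (Fin 3) (Fin 3) (SL3 × SL3 → ℂ)) =
      ((if b then X.1 else X.2 : SL3) : Matrix (Fin 3) (Fin 3) ℂ) := rfl
  cases s
  · simp only [letterMat, Bool.false_eq_true, if_false]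
    rw [Matrix.SpecialLinearGroup.coe_inv, ← h0, evM, evM, RingHom.map_adjugate]
  · simpa only [letterMat, if_true] using h0

/-- All words in the generic matrices. -/
noncomputable def wordMonoid : Submonoid (Matrix (Fin 3) (Fin 3) (SL3 × SL3 → ℂ)) where
  carrier := Set.range (wordMat genMat)
  one_mem' := ⟨[], wordMat_nil _⟩
  mul_mem' := by
    rintro _ _ ⟨l, rfl⟩ ⟨m, rfl⟩
    exact ⟨l ++ m, wordMat_append _ _ _⟩

theorem gen_mem_wordMonoid (b : Bool) :
    (genMat b : Matrix (Fin 3) (Fin 3) (SL3 × SL3 → ℂ)) ∈ wordMonoid :=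
  ⟨[(b, true)], by rw [wordMat_cons, wordMat_nil, mul_one]; simp [letterMat]⟩

theorem words_in_adjoin (R : Subalgebra ℂ (SL3 × SL3 → ℂ))
    (g1 : (fun X : SL3 × SL3 => tr3 X.1) ∈ R)
    (g2 : (fun X : SL3 × SL3 => tr3 X.2) ∈ R)
    (g3 : (fun X : SL3 × SL3 => tr3 (X.1 * X.2)) ∈ R)
    (g4 : (fun X : SL3 × SL3 => tr3 X.1⁻¹) ∈ R)
    (g5 : (fun X : SL3 × SL3 => tr3 X.2⁻¹) ∈ R)
    (g6 : (fun X : SL3 × SL3 => tr3 (X.1 * X.2⁻¹)) ∈ R)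
    (g7 : (fun X : SL3 × SL3 => tr3 (X.2 * X.1⁻¹)) ∈ R)
    (g8 : (fun X : SL3 × SL3 => tr3 (X.1⁻¹ * X.2⁻¹)) ∈ R)
    (g9 : (fun X : SL3 × SL3 => tr3 (X.1 * X.2 * X.1⁻¹ * X.2⁻¹)) ∈ R) :
    ∀ m ∈ wordMonoid, Matrix.trace m ∈ R := by
  have key : ∀ (A : Matrix (Fin 3) (Fin 3) (SL3 × SL3 → ℂ)) (u : SL3 × SL3 → ℂ), u ∈ R →
      (∀ X, (evM X A).trace = u X) → A.trace ∈ R := by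
    intro A u hu h
    have : A.trace = u := by funext X; rw [trace_evM, h]
    rwa [this]
  have comm : ∀ A B : SL3, ((A : Matrix (Fin 3) (Fin 3) ℂ) * (B : Matrix (Fin 3) (Fin 3) ℂ)).trace
      = tr3 (B * A) := by
    intro A B
    rw [Matrix.trace_mul_comm]
    exact congrArg Matrix.trace (Matrix.SpecialLinearGroup.coe_mul B A).symm
  have ncomm : ∀ A B : SL3, ((A : Matrix (Fin 3) (Fin 3) ℂ) * (B : Matrix (Fin 3) (Fin 3) ℂ)).trace
      = tr3 (A * B) := by
    intro A B
    exact congrArg Matrix.trace (Matrix.SpecialLinearGroup.coe_mul A B).symm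
  rintro _ ⟨l, rfl⟩
  refine all_words genMat R ?_ ?_ ?_ l
  · rintro ⟨b, s⟩
    rcases b with _ | _ <;> rcases s with _ | _
    · exact key _ _ g5 fun X => by rw [evM_letter]; rfl
    · exact key _ _ g2 fun X => by rw [evM_letter]; rfl
    · exact key _ _ g4 fun X => by rw [evM_letter]; rfl
    · exact key _ _ g1 fun X => by rw [evM_letter]; rfl
  · rintro ⟨b, s⟩ ⟨b', s'⟩ h
    rcases b with _ | _ <;> rcases b' with _ | _
    · exact absurd rfl h
    · rcases s with _ | _ <;> rcases s' with _ | _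
      · exact key _ _ g8 fun X => by rw [evM_mul, evM_letter, evM_letter]; exact comm _ _
      · exact key _ _ g6 fun X => by rw [evM_mul, evM_letter, evM_letter]; exact comm _ _
      · exact key _ _ g7 fun X => by rw [evM_mul, evM_letter, evM_letter]; exact ncomm _ _
      · exact key _ _ g3 fun X => by rw [evM_mul, evM_letter, evM_letter]; exact comm _ _
    · rcases s with _ | _ <;> rcases s' with _ | _
      · exact key _ _ g8 fun X => by rw [evM_mul, evM_letter, evM_letter]; exact ncomm _ _
      · exact key _ _ g7 fun X => by rw [evM_mul, evM_letter, evM_letter]; exact comm _ _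
      · exact key _ _ g6 fun X => by rw [evM_mul, evM_letter, evM_letter]; exact ncomm _ _
      · exact key _ _ g3 fun X => by rw [evM_mul, evM_letter, evM_letter]; exact ncomm _ _
    · exact absurd rfl h
  · refine key _ _ g9 fun X => ?_
    simp only [wordMat_cons, wordMat_nil, mul_one, evM_mul, evM_letter]
    simp only [tr3, Matrix.SpecialLinearGroup.coe_mul, if_true, Bool.false_eq_true, if_false,
      Matrix.mul_assoc]

theorem component_mem (R : Subalgebra ℂ (SL3 × SL3 → ℂ))
    (hR : ∀ m ∈ wordMonoid, Matrix.trace m ∈ R) {r} {q : (Fin 2 → SL3) → ℂ}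
    (hq : q ∈ resFun r)
    (hinv : ∀ (g : SL3) (X : Fin 2 → SL3), q (fun a => g * X a * g⁻¹) = q X) :
    (fun X : SL3 × SL3 => q ![X.1, X.2]) ∈ R := by
  obtain ⟨n, -, hf⟩ := hq
  obtain ⟨S, hS⟩ := homFun_tensor hf
  obtain ⟨a, ha⟩ := homog_invariant (Sigma.fst : (Σ a, Fin (n a)) → Fin 2) S (by
    intro g X
    rw [← hS X, ← hinv g X, hS])
  have e : (fun X : SL3 × SL3 => q ![X.1, X.2]) =
      ∑ h : Equiv.Perm (Σ a, Fin (n a)), a h • ∑ i : (Σ a, Fin (n a)) → Fin 3,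
        ∏ k, (genMat (decide (k.1 = 0)) : Matrix (Fin 3) (Fin 3) (SL3 × SL3 → ℂ))
          (i k) (i (h k)) := by
    funext X
    rw [hS, ha]
    simp only [Finset.sum_apply, Pi.smul_apply, smul_eq_mul, Finset.prod_apply]
    refine Finset.sum_congr rfl fun h _ => ?_
    congr 1
    refine Finset.sum_congr rfl fun i _ => Finset.prod_congr rfl fun k _ => ?_
    obtain ⟨b, k⟩ := k
    fin_cases b <;> rfl
  rw [e]
  refine sum_mem fun h _ => R.smul_mem ?_ _
  exact perm_sum_mem R wordMonoid hR _ h _ fun k => gen_mem_wordMonoid _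

end Assembly

/-- Every conjugation-invariant polynomial function on SL(3,ℂ)² is a polynomial
in the nine trace functions tr X₁, tr X₂, tr X₁X₂, tr X₁⁻¹, tr X₂⁻¹, tr X₁X₂⁻¹,
tr X₂X₁⁻¹, tr X₁⁻¹X₂⁻¹, tr X₁X₂X₁⁻¹X₂⁻¹. -/
theorem invariants_generated_by_nine_traces
    (f : SL3 × SL3 → ℂ)
    (hpoly : ∃ P : MvPolynomial (Fin 2 × Fin 3 × Fin 3) ℂ,
      ∀ X : SL3 × SL3,
        f X = MvPolynomial.eval
          (fun p => (![X.1, X.2] p.1 : Matrix (Fin 3) (Fin 3) ℂ) p.2.1 p.2.2) P)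
    (hinv : ∀ g : SL3, ∀ X : SL3 × SL3, f (g * X.1 * g⁻¹, g * X.2 * g⁻¹) = f X) :
    f ∈ Algebra.adjoin ℂ
      ({fun X : SL3 × SL3 => tr3 X.1,
        fun X : SL3 × SL3 => tr3 X.2,
        fun X : SL3 × SL3 => tr3 (X.1 * X.2),
        fun X : SL3 × SL3 => tr3 X.1⁻¹,
        fun X : SL3 × SL3 => tr3 X.2⁻¹,
        fun X : SL3 × SL3 => tr3 (X.1 * X.2⁻¹),
        fun X : SL3 × SL3 => tr3 (X.2 * X.1⁻¹),
        fun X : SL3 × SL3 => tr3 (X.1⁻¹ * X.2⁻¹),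
        fun X : SL3 × SL3 => tr3 (X.1 * X.2 * X.1⁻¹ * X.2⁻¹)} :
        Set ((SL3 × SL3) → ℂ)) := by
  obtain ⟨P, hP⟩ := hpoly
  obtain ⟨Q, hQ, hsum⟩ := exists_decomp P
  have hfX : ∀ X : Fin 2 → SL3, f (X 0, X 1) = ∑ r, Q r X := by
    intro X
    rw [hP, ← hsum]
    have hX : ![X 0, X 1] = X := by
      funext a
      fin_cases a <;> rfl
    rw [hX]
  have hQinv := component_inv Q hQ (by
    intro g X
    rw [← hfX, ← hfX]
    exact hinv g (X 0, X 1))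
  have e : f = ∑ r, fun X : SL3 × SL3 => Q r ![X.1, X.2] := by
    funext X
    rw [Finset.sum_apply]
    exact hfX ![X.1, X.2]
  rw [e]
  refine sum_mem fun r _ => component_mem _ ?_ (hQ r) (hQinv r)
  apply words_in_adjoin <;> exact Algebra.subset_adjoin (by simp)
end
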